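/- arXiv:2508.07463 — 4 statements merged into one kernel-verified Lean document; each statement's English description precedes it below -/
import Mathlib

section
/- There exist a constant C > 0 and an integer N such that for all n ≥ N and all integers k with 3 ≤ k ≤ n! − 3, one has |T(n,k)·n!²/binom(n!,k) − 1| ≤ C/n². In particular, T(n,k) = (1/n!²)·binom(n!,k)·(1 + O(n⁻²)) as n → ∞, uniformly over 3 ≤ k ≤ n! − 3. -/
open Equiv Finset

/-- Two `k`-subsets of `Sₙ` are equivalent if one is obtained from the other by
two-sided multiplication `σ ↦ g₁ * σ * g₂` for some pair `(g₁, g₂)`. -/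
def permSetRel (n k : ℕ) (x y : {s : Finset (Perm (Fin n)) // s.card = k}) : Prop :=
  ∃ g₁ g₂ : Perm (Fin n),
    (x : Finset (Perm (Fin n))).image (fun σ => g₁ * σ * g₂) = (y : Finset (Perm (Fin n)))

/-- `T n k` is the number of orbits of the action of `Sₙ × Sₙ` on the family of
`k`-element subsets of `Sₙ`. -/
noncomputable def T (n k : ℕ) : ℕ := Nat.card (Quot (permSetRel n k))

/-- number of `k`-sets fixed by a permutation -/
def fixk {X : Type*} [Fintype X] [DecidableEq X] (k : ℕ) (π : Perm X) : ℕ :=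
  ((powersetCard k (univ : Finset X)).filter (fun s => s.image π = s)).card

/-- number of points fixed by the `i`-th power of a permutation -/
def fixp {X : Type*} [Fintype X] [DecidableEq X] (i : ℕ) (π : Perm X) : ℕ :=
  ((univ : Finset X).filter (fun x => (π ^ i) x = x)).card

/-- two-sided multiplication -/
def tw {G : Type*} [Group G] : G × G →* Perm G where
  toFun g := (Equiv.mulLeft g.1).trans (Equiv.mulRight g.2⁻¹)
  map_one' := by ext; simp
  map_mul' a b := by ext; simp [mul_assoc]

theorem tw_apply {G : Type*} [Group G] (g : G × G) (x : G) : tw g x = g.1 * x * g.2⁻¹ := rfl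

theorem burnside (n k : ℕ) :
    T n k * n.factorial ^ 2 = ∑ g : Perm (Fin n) × Perm (Fin n), fixk k (tw g) := by
  classical
  let Y := {s : Finset (Perm (Fin n)) // s.card = k}
  let act : MulAction (Perm (Fin n) × Perm (Fin n)) Y :=
    { smul := fun g s => ⟨s.1.image (tw g), by
        rw [card_image_of_injective _ (tw g).injective]; exact s.2⟩
      one_smul := fun s => by
        apply Subtype.ext
        change s.1.image (tw 1) = s.1
        rw [map_one]; simp
      mul_smul := fun g h s => by
        apply Subtype.ext
        change s.1.image (tw (g * h)) = (s.1.image (tw h)).image (tw g)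
        rw [map_mul, image_image]; rfl }
  have hb := MulAction.sum_card_fixedBy_eq_card_orbits_mul_card_group
    (Perm (Fin n) × Perm (Fin n)) Y
  have hsm : ∀ (g : Perm (Fin n) × Perm (Fin n)) (s : Y), (g • s).1 = s.1.image (tw g) :=
    fun g s => rfl
  have e : Quot (permSetRel n k) ≃ Quotient (MulAction.orbitRel (Perm (Fin n) × Perm (Fin n)) Y) := by
    refine Quot.congrRight ?_
    intro x y
    rw [MulAction.orbitRel_apply]
    have : x ∈ MulAction.orbit (Perm (Fin n) × Perm (Fin n)) y ↔
      y ∈ MulAction.orbit (Perm (Fin n) × Perm (Fin n)) x := MulAction.mem_orbit_symm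
    rw [this]
    constructor
    · rintro ⟨g₁, g₂, h⟩
      refine ⟨(g₁, g₂⁻¹), Subtype.ext ?_⟩
      change x.1.image (tw (g₁, g₂⁻¹)) = y.1
      rw [← h]
      apply image_congr
      intro σ _
      simp [tw_apply]
    · rintro ⟨⟨g₁, g₂⟩, h⟩
      refine ⟨g₁, g₂⁻¹, ?_⟩
      have := congrArg Subtype.val h
      exact this
  have hT : T n k = Fintype.card (Quotient (MulAction.orbitRel (Perm (Fin n) × Perm (Fin n)) Y)) := by
    unfold T
    rw [Nat.card_congr e, Nat.card_eq_fintype_card]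
  rw [hT]
  have hc : Fintype.card (Perm (Fin n) × Perm (Fin n)) = n.factorial ^ 2 := by
    rw [Fintype.card_prod, Fintype.card_perm, Fintype.card_fin, sq]
  rw [← hc]
  refine Eq.trans ?_ (hb.symm.trans ?_)
  · rfl
  · refine Finset.sum_congr rfl fun g _ => ?_
    unfold fixk
    rw [← Fintype.card_coe]
    refine Fintype.card_congr ⟨fun s => ⟨s.1.1, ?_⟩, fun s => ⟨⟨s.1, ?_⟩, ?_⟩, ?_, ?_⟩
    · rw [mem_filter, mem_powersetCard]
      exact ⟨⟨subset_univ _, s.1.2⟩, congrArg Subtype.val s.2⟩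
    · exact (mem_powersetCard.1 (mem_filter.1 s.2).1).2
    · exact Subtype.ext (mem_filter.1 s.2).2
    · intro s; rfl
    · intro s; rfl

theorem fin_image_compl {X : Type*} [Fintype X] [DecidableEq X] (π : Perm X) (s : Finset X) :
    sᶜ.image π = (s.image π)ᶜ := by
  apply Finset.coe_injective
  rw [coe_image, coe_compl, coe_compl, coe_image, Set.image_compl_eq π.bijective]

theorem fixk_compl {X : Type*} [Fintype X] [DecidableEq X] (k : ℕ) (hk : k ≤ Fintype.card X)
    (π : Perm X) : fixk k π = fixk (Fintype.card X - k) π := by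
  unfold fixk
  refine card_bij' (fun s _ => sᶜ) (fun s _ => sᶜ) ?_ ?_ ?_ ?_
  · intro s hs
    simp only [mem_filter, mem_powersetCard, subset_univ, true_and] at hs ⊢
    refine ⟨by rw [card_compl, hs.1], ?_⟩
    rw [fin_image_compl, hs.2]
  · intro s hs
    simp only [mem_filter, mem_powersetCard, subset_univ, true_and] at hs ⊢
    refine ⟨by rw [card_compl, hs.1]; omega, ?_⟩
    rw [fin_image_compl, hs.2]
  · simp
  · simp

theorem exists_disj {X : Type*} [Fintype X] [DecidableEq X] (π : Perm X) :
    ∃ A : Finset X, Disjoint A (A.image π) ∧ π.support.card ≤ 3 * A.card := by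
  obtain ⟨A, hA, hmax⟩ := Finset.exists_max_image
    ((univ : Finset (Finset X)).filter (fun A => Disjoint A (A.image π))) Finset.card
    ⟨∅, by simp⟩
  rw [mem_filter] at hA
  refine ⟨A, hA.2, ?_⟩
  have hsub : π.support ⊆ A ∪ A.image π ∪ A.image π.symm := by
    intro x hx
    by_contra hcon
    simp only [mem_union, mem_image, not_or, not_exists, not_and] at hcon
    obtain ⟨⟨h1, h2⟩, h3⟩ := hcon
    have hx' : π x ≠ x := Perm.mem_support.1 hx
    have := hmax (insert x A) (by
      rw [mem_filter]
      refine ⟨mem_univ _, ?_⟩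
      rw [Finset.disjoint_left]
      intro a ha hb
      rw [mem_image] at hb
      obtain ⟨b, hb, hba⟩ := hb
      rw [mem_insert] at ha hb
      rcases ha with rfl | ha
      · rcases hb with rfl | hb
        · exact hx' hba
        · exact h2 b hb hba
      · rcases hb with rfl | hb
        · exact h3 a ha (by rw [← hba]; simp)
        · exact Finset.disjoint_left.1 hA.2 ha (mem_image.2 ⟨b, hb, hba⟩))
    rw [card_insert_of_notMem h1] at this
    omega
  calc π.support.card ≤ _ := card_le_card hsub
    _ ≤ (A ∪ A.image π).card + (A.image π.symm).card := card_union_le _ _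
    _ ≤ A.card + (A.image π).card + (A.image π.symm).card := by gcongr; exact card_union_le _ _
    _ ≤ A.card + A.card + A.card := add_le_add (add_le_add le_rfl card_image_le) card_image_le
    _ = _ := by ring

/-- generating function bound -/
theorem fixk_gf {X : Type*} [Fintype X] [DecidableEq X] (π : Perm X) (A : Finset X)
    (hA : Disjoint A (A.image π)) (k : ℕ) (t : ℝ) (ht : 0 ≤ t) :
    (fixk k π : ℝ) * t ^ k ≤ (1 + t ^ 2) ^ A.card * (1 + t) ^ (Fintype.card X - 2 * A.card) := by
  set B := A.image π with hB
  have hBc : B.card = A.card := card_image_of_injective _ π.injective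
  set w : X → ℝ := fun x => if x ∈ A then t ^ 2 else t with hw
  have hw0 : ∀ x, 0 ≤ w x := fun x => by simp only [hw]; split_ifs <;> positivity
  have h1 : ∑ U ∈ Bᶜ.powerset, ∏ x ∈ U, w x = ∏ x ∈ Bᶜ, (1 + w x) := by
    rw [Finset.prod_one_add]
  have hAB : A ⊆ Bᶜ := fun x hx => by
    rw [mem_compl]; exact Finset.disjoint_left.1 hA hx
  have h2 : ∏ x ∈ Bᶜ, (1 + w x) = (1 + t ^ 2) ^ A.card * (1 + t) ^ (Fintype.card X - 2 * A.card) := by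
    rw [← Finset.prod_sdiff hAB, mul_comm]
    congr 1
    · rw [Finset.prod_congr rfl (g := fun _ => 1 + t ^ 2), prod_const]
      intro x hx; simp [hw, hx]
    · rw [Finset.prod_congr rfl (g := fun _ => 1 + t), prod_const, card_sdiff_of_subset hAB,
        card_compl, hBc]
      · congr 1; omega
      · intro x hx; simp [hw, (mem_sdiff.1 hx).2]
  rw [← h2, ← h1]
  unfold fixk
  set F := (powersetCard k (univ : Finset X)).filter (fun s => s.image π = s) with hF
  have hmem : ∀ s ∈ F, s.card = k ∧ ∀ x, π x ∈ s ↔ x ∈ s := by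
    intro s hs
    simp only [hF, mem_filter, mem_powersetCard, subset_univ, true_and] at hs
    refine ⟨hs.1, fun x => ?_⟩
    conv_lhs => rw [← hs.2]
    simp
  have hinj : Set.InjOn (fun s : Finset X => s \ B) (F : Set (Finset X)) := by
    intro s hs s' hs' h
    have hs := hmem s hs
    have hs' := hmem s' hs'
    have key : ∀ x, x ∉ B → (x ∈ s ↔ x ∈ s') := by
      intro x hx
      have := congrArg (fun u => x ∈ u) h
      simpa [hx] using this
    ext x
    by_cases hx : x ∈ B
    · obtain ⟨a, ha, rfl⟩ := mem_image.1 hx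
      rw [hs.2, hs'.2]
      exact key a (Finset.disjoint_left.1 hA ha)
    · exact key x hx
  have hprod : ∀ s ∈ F, ∏ x ∈ s \ B, w x = t ^ k := by
    intro s hs
    have hs := hmem s hs
    have e1 : ∏ x ∈ s \ B, w x = (∏ x ∈ s \ B, t) * ∏ x ∈ s ∩ A, t := by
      have e0 : s ∩ A = (s \ B).filter (· ∈ A) := by
        ext x
        simp only [mem_inter, mem_filter, mem_sdiff]
        constructor
        · rintro ⟨a, b⟩; exact ⟨⟨a, Finset.disjoint_left.1 hA b⟩, b⟩
        · rintro ⟨⟨a, _⟩, b⟩; exact ⟨a, b⟩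
      rw [e0, Finset.prod_filter, ← Finset.prod_mul_distrib]
      refine Finset.prod_congr rfl fun x _ => ?_
      simp only [hw]; split_ifs <;> ring
    have e2 : (s ∩ A).card = (s ∩ B).card := by
      rw [← card_image_of_injective (s ∩ A) π.injective]
      congr 1
      ext x
      simp only [mem_image, mem_inter, hB]
      constructor
      · rintro ⟨a, ⟨h, h'⟩, rfl⟩; exact ⟨(hs.2 a).2 h, a, h', rfl⟩
      · rintro ⟨h, a, h', rfl⟩; exact ⟨a, ⟨(hs.2 a).1 h, h'⟩, rfl⟩
    rw [e1, prod_const, prod_const, e2, ← pow_add, card_sdiff_add_card_inter, hs.1]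
  calc (F.card : ℝ) * t ^ k = ∑ s ∈ F, ∏ x ∈ s \ B, w x := by
        rw [Finset.sum_congr rfl hprod]; simp
    _ = ∑ U ∈ F.image (fun s => s \ B), ∏ x ∈ U, w x := by rw [Finset.sum_image hinj]
    _ ≤ _ := by
        apply Finset.sum_le_sum_of_subset_of_nonneg
        · intro U hU
          obtain ⟨s, _, rfl⟩ := mem_image.1 hU
          rw [mem_powerset]
          intro x hx
          exact mem_compl.2 (mem_sdiff.1 hx).2
        · intro U _ _; exact Finset.prod_nonneg fun x _ => hw0 x

/-- the mode of the binomial distribution -/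
theorem choose_mode (N k : ℕ) (hk : k ≤ N) :
    (N : ℝ) ^ N ≤ (N + 1) * ((N.choose k : ℝ) * k ^ k * (N - k : ℝ) ^ (N - k)) := by
  set b : ℕ → ℝ := fun j => (N.choose j : ℝ) * k ^ j * (N - k : ℝ) ^ (N - j) with hb
  have hNk : (0 : ℝ) ≤ N - k := by rw [sub_nonneg]; exact_mod_cast hk
  have hb0 : ∀ j, 0 ≤ b j := fun j => by simp only [hb]; positivity
  have hrec : ∀ j, j < N → b (j + 1) * ((j + 1) * (N - k)) = b j * ((N - j) * k) := by
    intro j hj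
    have h1 : ((N.choose (j + 1) : ℝ)) * (j + 1) = N.choose j * (N - j) := by
      have := Nat.choose_succ_right_eq N j
      have h : ((N.choose (j + 1) * (j + 1) : ℕ) : ℝ) = ((N.choose j * (N - j) : ℕ) : ℝ) := by
        rw [this]
      push_cast [Nat.cast_sub hj.le] at h
      exact h
    have h2 : (N - j) = (N - (j + 1)) + 1 := by omega
    simp only [hb]
    rw [h2, pow_succ, pow_succ]
    linear_combination ((k : ℝ) ^ j * k * (N - k : ℝ) ^ (N - (j + 1)) * (N - k)) * h1
  have hle : ∀ j, j ≤ N → b j ≤ b k := by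
    rcases Nat.eq_zero_or_pos k with rfl | hk0
    · intro j hj
      rcases Nat.eq_zero_or_pos j with rfl | hj0
      · exact le_rfl
      · have : b j = 0 := by simp [hb, hj0.ne']
        rw [this]; exact hb0 _
    rcases hk.eq_or_lt with rfl | hkN
    · intro j hj
      rcases hj.eq_or_lt with rfl | hj0
      · exact le_rfl
      · have : b j = 0 := by
          simp only [hb, sub_self]
          rw [zero_pow (by omega)]; simp
        rw [this]; exact hb0 _
    have hk0' : (0 : ℝ) < k := by exact_mod_cast hk0
    have hkN' : (0 : ℝ) < N - k := by rw [sub_pos]; exact_mod_cast hkN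
    have up : ∀ j, j < k → b j ≤ b (j + 1) := by
      intro j hj
      have hj' : (j : ℝ) + 1 ≤ k := by exact_mod_cast hj
      have h := hrec j (by omega)
      have hpos : (0 : ℝ) < (j + 1) * (N - k) := by positivity
      refine le_of_mul_le_mul_right ?_ hpos
      rw [h]
      apply mul_le_mul_of_nonneg_left _ (hb0 _)
      nlinarith
    have down : ∀ j, k ≤ j → j < N → b (j + 1) ≤ b j := by
      intro j hj hjN
      have hj' : (k : ℝ) ≤ j := by exact_mod_cast hj
      have h := hrec j (by omega)
      have hpos : (0 : ℝ) < (j + 1) * (N - k) := by positivity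
      refine le_of_mul_le_mul_right ?_ hpos
      rw [h]
      apply mul_le_mul_of_nonneg_left _ (hb0 _)
      nlinarith
    intro j hj
    rcases le_total j k with h | h
    · have : ∀ d, ∀ j, j + d = k → b j ≤ b k := by
        intro d
        induction d with
        | zero => intro j hj; simp at hj; rw [hj]
        | succ d ih => intro j hj; exact (up j (by omega)).trans (ih (j + 1) (by omega))
      exact this (k - j) j (by omega)
    · have : ∀ d, k + d ≤ N → b (k + d) ≤ b k := by
        intro d
        induction d with
        | zero => intro _; exact le_rfl
        | succ d ih => intro hd; exact (down (k + d) (by omega) (by omega)).trans (ih (by omega))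
      obtain ⟨d, rfl⟩ := Nat.exists_eq_add_of_le h
      exact this d hj
  have hsum : (N : ℝ) ^ N = ∑ j ∈ range (N + 1), b j := by
    have := add_pow (k : ℝ) (N - k) N
    rw [add_sub_cancel] at this
    rw [this]
    refine Finset.sum_congr rfl fun j _ => ?_
    simp only [hb]; ring
  rw [hsum]
  calc _ ≤ ∑ j ∈ range (N + 1), b k := Finset.sum_le_sum fun j hj => hle j (by
        have := mem_range.1 hj; omega)
    _ = _ := by simp [hb]

theorem regime2 {X : Type*} [Fintype X] [DecidableEq X] (π : Perm X) (k : ℕ) (hk1 : 1 ≤ k)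
    (hk : 2 * k ≤ Fintype.card X) (hf : Fintype.card X ≤ 2 * π.support.card) :
    (fixk k π : ℝ) ≤ (Fintype.card X).choose k * ((Fintype.card X + 1) * Real.exp (-(k / 6))) := by
  obtain ⟨A, hA, hAc⟩ := exists_disj π
  set N := Fintype.card X with hN
  have h2A : 2 * A.card ≤ N := by
    have := card_union_of_disjoint hA
    rw [card_image_of_injective _ π.injective] at this
    have h := card_le_univ (A ∪ A.image π)
    omega
  have hkN : (k : ℝ) < N := by exact_mod_cast (by omega : k < N)
  have hk2 : 2 * (k : ℝ) ≤ N := by exact_mod_cast hk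
  have hk0 : (0 : ℝ) < k := by exact_mod_cast hk1
  have hNk : (0 : ℝ) < N - k := by linarith
  have hN0 : (0 : ℝ) < N := by linarith
  set t : ℝ := k / (N - k) with ht
  have ht0 : 0 < t := by positivity
  have h1 := fixk_gf π A hA k t ht0.le
  have h1t : 1 + t = N / (N - k) := by rw [ht]; field_simp; ring
  -- main
  have hkey : (1 + t ^ 2) ≤ (1 + t) ^ 2 * Real.exp (-(k / N)) := by
    have h : 1 + t ^ 2 = (1 + t) ^ 2 * (1 - 2 * k * (N - k) / N ^ 2) := by
      rw [h1t, ht]; field_simp; ring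
    rw [h]
    apply mul_le_mul_of_nonneg_left _ (by positivity)
    have h3 : (k : ℝ) / N ≤ 2 * k * (N - k) / N ^ 2 := by
      rw [div_le_div_iff₀ hN0 (by positivity)]
      nlinarith [mul_pos hk0 hN0]
    have := Real.add_one_le_exp (-(k / N : ℝ))
    linarith
  have h2 : (1 + t ^ 2) ^ A.card * (1 + t) ^ (N - 2 * A.card) ≤
      (1 + t) ^ N * Real.exp (-(k / 6)) := by
    calc _ ≤ ((1 + t) ^ 2 * Real.exp (-(k / N))) ^ A.card * (1 + t) ^ (N - 2 * A.card) := by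
          gcongr
      _ = (1 + t) ^ N * Real.exp (-(k / N)) ^ A.card := by
          rw [mul_pow, ← pow_mul, mul_right_comm, ← pow_add]
          congr 2; omega
      _ ≤ _ := by
          apply mul_le_mul_of_nonneg_left _ (by positivity)
          rw [← Real.exp_nat_mul]
          apply Real.exp_le_exp.2
          have h6 : (N : ℝ) ≤ 6 * A.card := by exact_mod_cast (by omega : N ≤ 6 * A.card)
          have : (k : ℝ) / 6 ≤ A.card * (k / N) := by
            rw [mul_div_assoc', div_le_div_iff₀ (by norm_num) hN0]
            nlinarith
          linarith
  have h3 := choose_mode N k (by omega)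
  have h4 : (1 + t) ^ N ≤ (N + 1) * (N.choose k) * t ^ k := by
    rw [h1t, ht, div_pow, div_pow, div_le_iff₀ (by positivity)]
    have : (N - k : ℝ) ^ N = (N - k : ℝ) ^ k * (N - k : ℝ) ^ (N - k) := by
      rw [← pow_add]; congr 1; omega
    rw [this]
    calc _ ≤ _ := h3
      _ = _ := by field_simp
  have h5 : (fixk k π : ℝ) * t ^ k ≤ (N.choose k * ((N + 1) * Real.exp (-(k / 6)))) * t ^ k := by
    calc _ ≤ _ := h1.trans h2
      _ ≤ ((N + 1) * (N.choose k) * t ^ k) * Real.exp (-(k / 6)) := by gcongr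
      _ = _ := by ring
  exact le_of_mul_le_mul_right h5 (by positivity)

theorem card_superset {X : Type*} [Fintype X] [DecidableEq X] (U : Finset X) (k : ℕ) :
    ((powersetCard k (univ : Finset X)).filter (fun s => U ⊆ s)).card * (Fintype.card X).choose U.card
      = (Fintype.card X).choose k * k.choose U.card := by
  by_cases hu : U.card ≤ k
  · have h : ((powersetCard k (univ : Finset X)).filter (fun s => U ⊆ s)).card =
        (Fintype.card X - U.card).choose (k - U.card) := by
      rw [← card_compl, ← card_powersetCard]
      refine card_bij' (fun s _ => s \ U) (fun s _ => s ∪ U) ?_ ?_ ?_ ?_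
      · intro s hs
        simp only [mem_filter, mem_powersetCard, subset_univ, true_and] at hs ⊢
        refine ⟨fun x hx => by simpa using (mem_sdiff.1 hx).2, ?_⟩
        rw [card_sdiff_of_subset hs.2, hs.1]
      · intro s hs
        simp only [mem_filter, mem_powersetCard, subset_univ, true_and] at hs ⊢
        refine ⟨?_, subset_union_right⟩
        rw [card_union_of_disjoint, hs.2]
        · omega
        · rw [Finset.disjoint_left]; intro x hx; simpa using hs.1 hx
      · intro s hs
        simp only [mem_filter] at hs
        exact sdiff_union_of_subset hs.2
      · intro s hs
        simp only [mem_powersetCard] at hs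
        rw [union_sdiff_right, sdiff_eq_self_of_disjoint]
        rw [Finset.disjoint_left]; intro x hx; simpa using hs.1 hx
    rw [h]
    by_cases hk : k ≤ Fintype.card X
    · rw [Nat.choose_mul hu, mul_comm]
    · rw [Nat.choose_eq_zero_of_lt (show Fintype.card X < k by omega),
        Nat.choose_eq_zero_of_lt (show Fintype.card X - U.card < k - U.card by
          have := card_le_univ U; omega)]
      simp
  · rw [Nat.choose_eq_zero_of_lt (show k < U.card by omega), mul_zero]
    convert zero_mul _
    rw [card_eq_zero, filter_eq_empty_iff]
    intro s hs h
    have := card_le_card h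
    rw [mem_powersetCard] at hs
    omega

theorem choose_ratio (N k m : ℕ) (hk : k ≤ N) :
    k.choose (3 + m) * N.choose 3 * N ^ m ≤ N.choose (3 + m) * k.choose 3 * k ^ m := by
  induction m with
  | zero => simp [mul_comm]
  | succ m ih =>
    have e1 := Nat.choose_succ_right_eq k (3 + m)
    have e2 := Nat.choose_succ_right_eq N (3 + m)
    have hstep : (k - (3 + m)) * N ≤ (N - (3 + m)) * k := by
      rw [Nat.sub_mul, Nat.sub_mul, mul_comm k N]
      exact Nat.sub_le_sub_left (Nat.mul_le_mul_left _ hk) _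
    refine Nat.le_of_mul_le_mul_right (c := 3 + m + 1) ?_ (by omega)
    calc k.choose (3 + (m + 1)) * N.choose 3 * N ^ (m + 1) * (3 + m + 1)
        = (k.choose (3 + m + 1) * (3 + m + 1)) * N.choose 3 * N ^ (m + 1) := by
          rw [← add_assoc]; ring
      _ = (k.choose (3 + m) * N.choose 3 * N ^ m) * ((k - (3 + m)) * N) := by rw [e1]; ring
      _ ≤ (N.choose (3 + m) * k.choose 3 * k ^ m) * ((N - (3 + m)) * k) :=
          Nat.mul_le_mul ih hstep
      _ = (N.choose (3 + m + 1) * (3 + m + 1)) * k.choose 3 * k ^ (m + 1) := by rw [e2]; ring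
      _ = _ := by rw [← add_assoc]; ring

/-- number of triples with few new points -/
def trip {X : Type*} [Fintype X] [DecidableEq X] (j : ℕ) (π : Perm X) : Finset (Finset X) :=
  (powersetCard 3 (univ : Finset X)).filter (fun t => (t.image π \ t).card ≤ j)

theorem regime1 {X : Type*} [Fintype X] [DecidableEq X] (π : Perm X) (k : ℕ) (hk3 : 3 ≤ k)
    (hk : k ≤ Fintype.card X) (q : ℝ) (hq : q = k / Fintype.card X) :
    (fixk k π : ℝ) * (Fintype.card X).choose 3 ≤ (Fintype.card X).choose k *
      ((trip 0 π).card + q * (trip 1 π).card + q ^ 2 * (trip 2 π).card +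
        q ^ 3 * (Fintype.card X).choose 3) := by
  set N := Fintype.card X with hN
  have hN0 : (0 : ℝ) < N := by exact_mod_cast (by omega : 0 < N)
  have hq0 : 0 ≤ q := by rw [hq]; positivity
  set P3 := powersetCard 3 (univ : Finset X) with hP3
  set F := (powersetCard k (univ : Finset X)).filter (fun s => s.image π = s) with hF
  set m : Finset X → ℕ := fun t => (t.image π \ t).card with hm
  have hm3 : ∀ t ∈ P3, m t ≤ 3 := by
    intro t ht
    calc m t ≤ (t.image π).card := card_le_card sdiff_subset
      _ ≤ t.card := card_image_le
      _ = 3 := (mem_powersetCard.1 ht).2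
  -- double counting
  have h1 : (fixk k π) * k.choose 3 = ∑ t ∈ P3, (F.filter (fun s => t ⊆ s)).card := by
    have : ∀ s ∈ F, (P3.filter (fun t => t ⊆ s)).card = k.choose 3 := by
      intro s hs
      have hs : s.card = k := (mem_powersetCard.1 (mem_filter.1 hs).1).2
      rw [← hs, ← card_powersetCard]
      congr 1
      ext t
      simp only [hP3, mem_filter, mem_powersetCard, subset_univ, true_and]
      tauto
    unfold fixk
    rw [← smul_eq_mul, ← Finset.sum_const, ← Finset.sum_congr rfl this]
    simp only [card_filter]
    exact Finset.sum_comm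
  have h2 : ∀ t ∈ P3, ((F.filter (fun s => t ⊆ s)).card : ℝ) * N.choose 3 ≤
      N.choose k * k.choose 3 * q ^ m t := by
    intro t ht
    have ht3 : t.card = 3 := (mem_powersetCard.1 ht).2
    set U := t ∪ t.image π with hU
    have hUc : U.card = 3 + m t := by
      rw [hU, ← union_sdiff_self_eq_union, card_union_of_disjoint disjoint_sdiff, ht3]
    have hle : (F.filter (fun s => t ⊆ s)).card ≤
        ((powersetCard k (univ : Finset X)).filter (fun s => U ⊆ s)).card := by
      apply card_le_card
      intro s hs
      simp only [hF, mem_filter] at hs ⊢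
      refine ⟨hs.1.1, union_subset hs.2 ?_⟩
      rw [← hs.1.2]
      exact image_subset_image hs.2
    by_cases hkU : U.card ≤ k
    · have e := card_superset U k
      have r := choose_ratio N k (m t) hk
      rw [← hUc] at r
      have hpos : 0 < N.choose U.card := Nat.choose_pos (by omega)
      have key : (F.filter (fun s => t ⊆ s)).card * N.choose 3 * N ^ m t ≤
          N.choose k * k.choose 3 * k ^ m t := by
        refine Nat.le_of_mul_le_mul_right (c := N.choose U.card) ?_ hpos
        calc _ ≤ ((powersetCard k (univ : Finset X)).filter (fun s => U ⊆ s)).card * N.choose 3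
                * N ^ m t * N.choose U.card := by gcongr
          _ = (((powersetCard k (univ : Finset X)).filter (fun s => U ⊆ s)).card * N.choose U.card)
                * N.choose 3 * N ^ m t := by ring
          _ = N.choose k * (k.choose U.card * N.choose 3 * N ^ m t) := by rw [e]; ring
          _ ≤ N.choose k * (N.choose U.card * k.choose 3 * k ^ m t) := by gcongr
          _ = _ := by ring
      rw [hq, div_pow, mul_div_assoc', le_div_iff₀ (by positivity)]
      exact_mod_cast key
    · have h0 : (F.filter (fun s => t ⊆ s)).card = 0 := by
        have : ((powersetCard k (univ : Finset X)).filter (fun s => U ⊆ s)).card = 0 := by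
          rw [card_eq_zero, filter_eq_empty_iff]
          intro s hs h
          have := card_le_card h
          rw [mem_powersetCard] at hs
          omega
        omega
      rw [h0]; simp; positivity
  have h3 : ∑ t ∈ P3, q ^ m t ≤ (trip 0 π).card + q * (trip 1 π).card + q ^ 2 * (trip 2 π).card +
        q ^ 3 * N.choose 3 := by
    have hc : ∀ j, ((trip j π).card : ℝ) = ∑ t ∈ P3, if m t ≤ j then (1 : ℝ) else 0 := by
      intro j
      rw [trip, card_filter]; push_cast; rfl
    have hc3 : ((N.choose 3 : ℕ) : ℝ) = ∑ t ∈ P3, (1 : ℝ) := by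
      rw [sum_const, hP3, card_powersetCard, card_univ]; simp [hN]
    rw [hc, hc, hc, hc3, mul_sum, mul_sum, mul_sum, ← sum_add_distrib, ← sum_add_distrib,
      ← sum_add_distrib]
    refine sum_le_sum fun t ht => ?_
    have := hm3 t ht
    have p2 : 0 ≤ q ^ 2 := by positivity
    have p3 : 0 ≤ q ^ 3 := by positivity
    rcases (by omega : m t = 0 ∨ m t = 1 ∨ m t = 2 ∨ m t = 3) with h | h | h | h <;> rw [h] <;>
      norm_num <;> linarith
  have hk0 : (0 : ℝ) < k.choose 3 := by exact_mod_cast Nat.choose_pos hk3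
  refine le_of_mul_le_mul_right ?_ hk0
  calc (fixk k π : ℝ) * N.choose 3 * k.choose 3
      = ((fixk k π * k.choose 3 : ℕ) : ℝ) * N.choose 3 := by push_cast; ring
    _ = ∑ t ∈ P3, ((F.filter (fun s => t ⊆ s)).card : ℝ) * N.choose 3 := by
        rw [h1]; push_cast; rw [sum_mul]
    _ ≤ ∑ t ∈ P3, N.choose k * k.choose 3 * q ^ m t := sum_le_sum h2
    _ = N.choose k * (∑ t ∈ P3, q ^ m t) * k.choose 3 := by rw [← mul_sum]; ring
    _ ≤ _ := by gcongr

theorem trip_filter {X : Type*} [Fintype X] [DecidableEq X] (π : Perm X) (j : ℕ) (t : Finset X)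
    (ht : t ∈ trip j π) : t.card = 3 ∧ 3 ≤ (t.filter (fun x => π x ∈ t)).card + j := by
  simp only [trip, mem_filter, mem_powersetCard, subset_univ, true_and] at ht
  refine ⟨ht.1, ?_⟩
  have h : (t.filter (fun x => ¬ π x ∈ t)).card = (t.image π \ t).card := by
    rw [← card_image_of_injective _ π.injective]
    congr 1
    ext x
    simp only [mem_image, mem_filter, mem_sdiff]
    constructor
    · rintro ⟨a, ⟨h1, h2⟩, rfl⟩; exact ⟨⟨a, h1, rfl⟩, h2⟩
    · rintro ⟨⟨a, h1, rfl⟩, h2⟩; exact ⟨a, ⟨h1, h2⟩, rfl⟩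
  have := card_filter_add_card_filter_not (s := t) (fun x => π x ∈ t)
  omega

theorem trip0 {X : Type*} [Fintype X] [DecidableEq X] (π : Perm X) :
    (trip 0 π).card ≤ fixp 1 π ^ 3 + fixp 1 π * fixp 2 π + fixp 3 π := by
  set F1 := (univ : Finset X).filter (fun x => (π ^ 1) x = x) with hF1
  set F2 := (univ : Finset X).filter (fun x => (π ^ 2) x = x) with hF2
  set F3 := (univ : Finset X).filter (fun x => (π ^ 3) x = x) with hF3
  have hsub : trip 0 π ⊆ (F1 ×ˢ F1 ×ˢ F1).image (fun p => {p.1, p.2.1, p.2.2}) ∪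
      (F1 ×ˢ F2).image (fun p => {p.1, p.2, π p.2}) ∪
      F3.image (fun x => {x, π x, π (π x)}) := by
    intro t ht
    obtain ⟨h3, hf⟩ := trip_filter π 0 t ht
    have hall : ∀ x ∈ t, π x ∈ t := by
      have : t.filter (fun x => π x ∈ t) = t := by
        apply eq_of_subset_of_card_le (filter_subset _ _); omega
      intro x hx; rw [← this] at hx; exact (mem_filter.1 hx).2
    obtain ⟨x, y, z, hxy, hxz, hyz, rfl⟩ := card_eq_three.1 h3
    have hx := hall x (by simp)
    have hy := hall y (by simp)
    have hz := hall z (by simp)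
    have ixy : π x ≠ π y := fun h => hxy (π.injective h)
    have ixz : π x ≠ π z := fun h => hxz (π.injective h)
    have iyz : π y ≠ π z := fun h => hyz (π.injective h)
    simp only [mem_insert, mem_singleton] at hx hy hz
    simp only [mem_union, mem_image, mem_product, Prod.exists, hF1, hF2, hF3, mem_filter, mem_univ,
      true_and, pow_one, pow_succ, pow_zero, one_mul, Perm.mul_apply]
    clear hall hf h3 ht
    rcases hx with hx | hx | hx <;> rcases hy with hy | hy | hy <;>
      rcases hz with hz | hz | hz <;> first
      | (exfalso; simp_all; done)
      | (left; left; exact ⟨x, y, z, ⟨hx, hy, hz⟩, rfl⟩)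
      | (left; right; refine ⟨x, y, ⟨hx, by rw [hy, hz]⟩, ?_⟩; rw [hy])
      | (left; right; refine ⟨y, x, ⟨hy, by simp [hx, hz]⟩, ?_⟩; rw [hx]; ext w; simp; tauto)
      | (left; right; refine ⟨z, x, ⟨hz, by simp [hx, hy]⟩, ?_⟩; rw [hx]; ext w; simp; tauto)
      | (right; refine ⟨x, by simp [hx, hy, hz], ?_⟩; simp [hx, hy, hz]; done)
      | (right; refine ⟨x, by simp [hx, hy, hz], ?_⟩; rw [hx, hz]; ext w; simp; tauto)
  calc (trip 0 π).card ≤ _ := card_le_card hsub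
    _ ≤ (F1 ×ˢ F1 ×ˢ F1).card + (F1 ×ˢ F2).card + F3.card :=
      (card_union_le _ _).trans (add_le_add ((card_union_le _ _).trans
        (add_le_add card_image_le card_image_le)) card_image_le)
    _ = _ := by
      rw [card_product, card_product, card_product]
      change F1.card * (F1.card * F1.card) + F1.card * F2.card + F3.card =
        F1.card ^ 3 + F1.card * F2.card + F3.card
      ring

theorem trip1 {X : Type*} [Fintype X] [DecidableEq X] (π : Perm X) :
    (trip 1 π).card ≤ fixp 1 π ^ 2 * Fintype.card X + fixp 1 π * Fintype.card X
      + fixp 2 π * Fintype.card X + Fintype.card X := by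
  set F1 := (univ : Finset X).filter (fun x => (π ^ 1) x = x) with hF1
  set F2 := (univ : Finset X).filter (fun x => (π ^ 2) x = x) with hF2
  have hsub : trip 1 π ⊆ (F1 ×ˢ F1 ×ˢ (univ : Finset X)).image (fun p => {p.1, p.2.1, p.2.2}) ∪
      (F1 ×ˢ (univ : Finset X)).image (fun p => {p.1, p.2, π p.2}) ∪
      (F2 ×ˢ (univ : Finset X)).image (fun p => {p.1, π p.1, p.2}) ∪
      (univ : Finset X).image (fun x => {x, π x, π (π x)}) := by
    intro t ht
    obtain ⟨h3, hf⟩ := trip_filter π 1 t ht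
    obtain ⟨x, hx, y, hy, hxy⟩ := one_lt_card.1 (by omega : 1 < (t.filter (fun x => π x ∈ t)).card)
    rw [mem_filter] at hx hy
    obtain ⟨z, hz⟩ := card_eq_one.1 (show ((t.erase x).erase y).card = 1 by
      rw [card_erase_of_mem (mem_erase.2 ⟨hxy.symm, hy.1⟩), card_erase_of_mem hx.1, h3])
    have htt : t = {x, y, z} := by
      rw [← insert_erase hx.1, ← insert_erase (mem_erase.2 ⟨hxy.symm, hy.1⟩), hz]
    have hzm : z ∈ (t.erase x).erase y := by rw [hz]; simp
    simp only [mem_erase] at hzm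
    obtain ⟨hzy, hzx, -⟩ := hzm
    obtain ⟨-, hx⟩ := hx
    obtain ⟨-, hy⟩ := hy
    clear hz hf h3 ht
    subst htt
    have ixy : π x ≠ π y := fun h => hxy (π.injective h)
    simp only [mem_insert, mem_singleton] at hx hy
    simp only [mem_union, mem_image, mem_product, Prod.exists, hF1, hF2, mem_filter, mem_univ,
      true_and, and_true, pow_one, pow_succ, pow_zero, one_mul, Perm.mul_apply]
    rcases hx with hx | hx | hx <;> rcases hy with hy | hy | hy <;> first
      | (exfalso; simp_all; done)
      | (left; left; left; exact ⟨x, y, z, ⟨hx, hy⟩, rfl⟩)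
      | (left; left; right; refine ⟨x, y, hx, ?_⟩; rw [hy]; done)
      | (left; left; right; refine ⟨y, x, hy, ?_⟩; rw [hx]; ext w; simp; tauto)
      | (left; right; refine ⟨x, z, ?_, ?_⟩ <;> (simp [hx, hy]; done))
      | (right; refine ⟨x, ?_⟩; rw [hx, hy]; done)
      | (right; refine ⟨y, ?_⟩; rw [hy, hx]; ext w; simp; tauto)
  calc (trip 1 π).card ≤ _ := card_le_card hsub
    _ ≤ (F1 ×ˢ F1 ×ˢ (univ : Finset X)).card + (F1 ×ˢ (univ : Finset X)).card +
        (F2 ×ˢ (univ : Finset X)).card + (univ : Finset X).card :=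
      (card_union_le _ _).trans (add_le_add ((card_union_le _ _).trans (add_le_add
        ((card_union_le _ _).trans
        (add_le_add card_image_le card_image_le)) card_image_le)) card_image_le)
    _ = _ := by
      simp only [card_product, card_univ]
      change F1.card * (F1.card * _) + F1.card * _ + F2.card * _ + _ =
        F1.card ^ 2 * _ + F1.card * _ + F2.card * _ + _
      ring

theorem trip2 {X : Type*} [Fintype X] [DecidableEq X] (π : Perm X) :
    (trip 2 π).card ≤ fixp 1 π * Fintype.card X ^ 2 + Fintype.card X ^ 2 := by
  set F1 := (univ : Finset X).filter (fun x => (π ^ 1) x = x) with hF1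
  have hsub : trip 2 π ⊆ (F1 ×ˢ (univ : Finset X) ×ˢ (univ : Finset X)).image
        (fun p => {p.1, p.2.1, p.2.2}) ∪
      ((univ : Finset X) ×ˢ (univ : Finset X)).image (fun p => {p.1, π p.1, p.2}) := by
    intro t ht
    obtain ⟨h3, hf⟩ := trip_filter π 2 t ht
    obtain ⟨x, hx⟩ := card_pos.1 (by omega : 0 < (t.filter (fun x => π x ∈ t)).card)
    rw [mem_filter] at hx
    obtain ⟨y, z, hyz, hz⟩ := card_eq_two.1 (show (t.erase x).card = 2 by
      rw [card_erase_of_mem hx.1, h3])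
    have htt : t = {x, y, z} := by
      rw [← insert_erase hx.1, hz]
    obtain ⟨-, hx⟩ := hx
    clear hz hf h3 ht
    subst htt
    simp only [mem_insert, mem_singleton] at hx
    simp only [mem_union, mem_image, mem_product, Prod.exists, hF1, mem_filter, mem_univ,
      true_and, and_true, pow_one]
    rcases hx with hx | hx | hx 
    · left; exact ⟨x, y, z, hx, rfl⟩
    · right; exact ⟨x, z, by rw [hx]⟩
    · right; refine ⟨x, y, ?_⟩; rw [hx]; ext w; simp; tauto
  calc (trip 2 π).card ≤ _ := card_le_card hsub
    _ ≤ (F1 ×ˢ (univ : Finset X) ×ˢ (univ : Finset X)).card + ((univ : Finset X) ×ˢ (univ : Finset X)).card :=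
      ((card_union_le _ _).trans
        (add_le_add card_image_le card_image_le))
    _ = _ := by
      rw [card_product, card_product, card_univ]
      change F1.card * (_ * _) + _ * _ = F1.card * _ ^ 2 + _
      ring

/-- size of the centralizer -/
def cz {G : Type*} [Group G] [Fintype G] [DecidableEq G] (h : G) : ℕ :=
  ((univ : Finset G).filter (fun u => h * u = u * h)).card

section grp
variable {G : Type*} [Group G] [Fintype G] [DecidableEq G]

theorem fixp_tw (i : ℕ) (g : G × G) :
    fixp i (tw g) = ((univ : Finset G).filter (fun x => g.1 ^ i * x = x * g.2 ^ i)).card := by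
  unfold fixp
  congr 1
  ext x
  simp only [mem_filter, mem_univ, true_and]
  rw [← map_pow, tw_apply, mul_inv_eq_iff_eq_mul]
  rfl

theorem fixp_conj (i : ℕ) (h x : G) : fixp i (tw (h, x⁻¹ * h * x)) = cz (h ^ i) := by
  rw [fixp_tw, cz]
  refine card_bij' (fun y _ => y * x⁻¹) (fun y _ => y * x) ?_ ?_ ?_ ?_
  · intro y hy
    simp only [mem_filter, mem_univ, true_and] at hy ⊢
    have : (x⁻¹ * h * x) ^ i = x⁻¹ * h ^ i * x := by
      have := conj_pow (i := i) (a := x⁻¹) (b := h)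
      simpa using this
    rw [this] at hy
    rw [← mul_assoc, hy]; group
  · intro y hy
    simp only [mem_filter, mem_univ, true_and] at hy ⊢
    have : (x⁻¹ * h * x) ^ i = x⁻¹ * h ^ i * x := by
      have := conj_pow (i := i) (a := x⁻¹) (b := h)
      simpa using this
    rw [this, ← mul_assoc, hy]; group
  · intro y _; simp
  · intro y _; simp

theorem sum_fix_mul (F : G × G → ℕ) :
    ∑ g : G × G, fixp 1 (tw g) * F g = ∑ h : G, ∑ x : G, F (h, x⁻¹ * h * x) := by
  simp only [fixp_tw, card_filter, sum_mul, ite_mul, one_mul, zero_mul, pow_one]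
  rw [Fintype.sum_prod_type]
  refine sum_congr rfl fun a _ => ?_
  rw [sum_comm]
  refine sum_congr rfl fun x _ => ?_
  rw [Fintype.sum_eq_single (x⁻¹ * a * x)]
  · rw [if_pos (by group)]
  · intro b hb
    rw [if_neg]
    intro h
    apply hb
    rw [mul_assoc, h]; group

theorem sum_f1 : ∑ g : G × G, fixp 1 (tw g) = Fintype.card G ^ 2 := by
  have := sum_fix_mul (G := G) (fun _ => 1)
  simp only [mul_one] at this
  rw [this]; simp [sq]

theorem sum_f1f2 : ∑ g : G × G, fixp 1 (tw g) * fixp 2 (tw g) =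
    Fintype.card G * ∑ h : G, cz (h ^ 2) := by
  rw [sum_fix_mul (fun g => fixp 2 (tw g))]
  simp only [fixp_conj, sum_const, card_univ, smul_eq_mul, mul_sum]

theorem sum_f1sq : ∑ g : G × G, fixp 1 (tw g) ^ 2 = Fintype.card G * ∑ h : G, cz h := by
  simp only [sq]
  rw [sum_fix_mul (fun g => fixp 1 (tw g))]
  simp only [fixp_conj, sum_const, card_univ, smul_eq_mul, mul_sum, pow_one]

theorem sum_f1cube : ∑ g : G × G with g ≠ 1, fixp 1 (tw g) ^ 3 =
    Fintype.card G * ∑ h : G with h ≠ 1, cz h ^ 2 := by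
  have h1 := sum_fix_mul (fun g : G × G => if g ≠ 1 then fixp 1 (tw g) ^ 2 else 0)
  rw [sum_filter, sum_filter]
  calc _ = _ := sum_congr rfl fun g _ => by
        change _ = fixp 1 (tw g) * _
        split_ifs <;> ring
    _ = _ := h1
    _ = _ := by
      rw [mul_sum]
      refine sum_congr rfl fun h _ => ?_
      have : ∀ x : G, ((h, x⁻¹ * h * x) : G × G) ≠ 1 ↔ h ≠ 1 := by
        intro x
        rw [not_iff_not, Prod.mk_eq_one]
        constructor
        · exact fun h => h.1
        · rintro rfl; simp
      simp only [this, fixp_conj, pow_one, sum_const, card_univ, smul_eq_mul]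

theorem sum_fi (i : ℕ) : ∑ g : G × G, fixp i (tw g) =
    Fintype.card G * ∑ a : G, ((univ : Finset G).filter (fun b => b ^ i = a ^ i)).card := by
  simp only [fixp_tw, card_filter]
  rw [sum_comm]
  have : ∀ x : G, ∑ g : G × G, (if g.1 ^ i * x = x * g.2 ^ i then 1 else 0) =
      ∑ a : G, ∑ b : G, if b ^ i = a ^ i then 1 else 0 := by
    intro x
    rw [Fintype.sum_prod_type]
    refine Fintype.sum_equiv (MulAut.conj x⁻¹).toEquiv _ _ fun a => ?_
    refine sum_congr rfl fun b _ => ?_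
    have e : ((MulAut.conj x⁻¹).toEquiv a) ^ i = x⁻¹ * a ^ i * x := by
      have := map_pow (MulAut.conj x⁻¹) a i
      simp only [MulAut.conj_apply, inv_inv] at this
      rw [this]
      simp
    rw [e]
    congr 1
    rw [mul_assoc, eq_inv_mul_iff_mul_eq]
    exact propext eq_comm
  simp only [this, sum_const, card_univ, smul_eq_mul]

theorem sum_sq_le : ∑ a : G, ((univ : Finset G).filter (fun b => b ^ 2 = a ^ 2)).card ≤
    ∑ w : G, cz w := by
  have h1 : ∑ a : G, ((univ : Finset G).filter (fun b => b ^ 2 = a ^ 2)).card ≤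
      ∑ a : G, ((univ : Finset G).filter (fun w => a⁻¹ * w * a = w⁻¹)).card := by
    refine sum_le_sum fun a _ => ?_
    refine card_le_card_of_injOn (fun b => a * b⁻¹) ?_ ?_
    · intro b hb
      simp only [coe_filter, mem_univ, true_and, Set.mem_ofPred_eq] at hb ⊢
      have : b⁻¹ * a * a = b := by rw [mul_assoc, ← sq, ← hb, sq]; group
      calc a⁻¹ * (a * b⁻¹) * a = b⁻¹ * a * a * a⁻¹ := by group
        _ = b * a⁻¹ := by rw [this]
        _ = _ := by group
    · intro b _ c _ h
      simpa using h
  refine h1.trans ?_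
  simp only [card_filter]
  rw [sum_comm]
  simp only [← card_filter]
  refine sum_le_sum fun w _ => ?_
  rcases ((univ : Finset G).filter (fun a => a⁻¹ * w * a = w⁻¹)).eq_empty_or_nonempty with h | ⟨a0, h0⟩
  · rw [h]; simp
  · simp only [mem_filter, mem_univ, true_and] at h0
    refine card_le_card_of_injOn (fun a => a * a0⁻¹) ?_ ?_
    · intro a ha
      simp only [coe_filter, mem_univ, true_and, Set.mem_ofPred_eq] at ha ⊢
      have e : w * a = a * w⁻¹ := by rw [← ha]; group
      have e' : a0⁻¹ * w = w⁻¹ * a0⁻¹ := by rw [← h0]; group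
      rw [← mul_assoc, e, mul_assoc, mul_assoc, e']
    · intro b _ c _ h
      simpa using h

theorem invol_sq_le : ((univ : Finset G).filter (fun b => b ^ 2 = 1)).card ^ 2 ≤ ∑ w : G, cz w := by
  refine le_trans ?_ sum_sq_le
  rw [sq, ← smul_eq_mul, ← sum_const]
  calc _ = ∑ a ∈ (univ : Finset G).filter (fun b => b ^ 2 = 1),
        ((univ : Finset G).filter (fun b => b ^ 2 = a ^ 2)).card := by
        refine sum_congr rfl fun a ha => ?_
        rw [(mem_filter.1 ha).2]
    _ ≤ _ := sum_le_sum_of_subset (filter_subset _ _)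

theorem sum_cz : ∑ w : G, cz w = Nat.card (ConjClasses G) * Fintype.card G := by
  classical
  have := card_comm_eq_card_conjClasses_mul_card G
  rw [Nat.card_eq_fintype_card (α := G)] at this
  rw [← this, Nat.card_eq_fintype_card, Fintype.card_subtype, ← univ_product_univ]
  simp only [cz, card_filter]
  rw [sum_product]
  refine sum_congr rfl fun a _ => sum_congr rfl fun b _ => ?_
  by_cases h : a * b = b * a
  · have h' : Commute (a, b).1 (a, b).2 := h
    rw [if_pos h, if_pos h']
  · have h' : ¬ Commute (a, b).1 (a, b).2 := h
    rw [if_neg h, if_neg h']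

theorem cz_le (h : G) : cz h ≤ Fintype.card G := card_le_univ _

theorem group_bound (δ P : ℝ) (hδ : 0 ≤ δ) (hN : 6 ≤ Fintype.card G)
    (h1 : ∀ h : G, h ≠ 1 → (cz h : ℝ) ≤ δ * Fintype.card G)
    (h2 : ∑ h : G with h ≠ 1, (cz h : ℝ) ^ 2 ≤ δ * Fintype.card G ^ 2)
    (hP : ∑ h : G, (cz h : ℝ) ≤ P * Fintype.card G) (k : ℕ) (hk3 : 3 ≤ k)
    (hk : k ≤ Fintype.card G) :
    ∑ g : G × G with g ≠ 1, (fixk k (tw g) : ℝ) ≤ (Fintype.card G).choose k * (12 *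
      (3 * δ + ((univ : Finset G).filter (fun b => b ^ 2 = 1)).card / Fintype.card G
       + (((univ : Finset G).filter (fun b => b ^ 3 = 1)).card / Fintype.card G) ^ 2
       + (2 * P + 2) * k / Fintype.card G + 2 * k ^ 2 / Fintype.card G
       + k ^ 3 / Fintype.card G)) := by
  set N := Fintype.card G with hNdef
  set i2 := ((univ : Finset G).filter (fun b => b ^ 2 = 1)).card with hi2
  set r := ((univ : Finset G).filter (fun b => b ^ 3 = 1)).card with hr
  have hN6 : (6 : ℝ) ≤ N := by exact_mod_cast hN
  have hN0 : (0 : ℝ) < N := by linarith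
  have hsub : ∀ f : G × G → ℝ, (∀ g, 0 ≤ f g) → ∑ g : G × G with g ≠ 1, f g ≤ ∑ g : G × G, f g :=
    fun f hf => sum_le_sum_of_subset_of_nonneg (filter_subset _ _) fun g _ _ => hf g
  have hb : ∑ h : G, (cz (h ^ 2) : ℝ) ≤ i2 * N + N * (δ * N) := by
    calc ∑ h : G, (cz (h ^ 2) : ℝ) ≤ ∑ h : G, ((if h ^ 2 = 1 then (N : ℝ) else 0) + δ * N) := by
          refine sum_le_sum fun h _ => ?_
          split_ifs with hh
          · have : (cz (h ^ 2) : ℝ) ≤ N := by exact_mod_cast (cz_le _ : cz (h ^ 2) ≤ N)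
            have : 0 ≤ δ * N := by positivity
            linarith
          · rw [zero_add]; exact h1 _ hh
      _ = _ := by
          rw [sum_add_distrib, ← sum_filter, sum_const, sum_const, card_univ]
          simp [hi2, hNdef]
  have hc : ∑ a : G, (((univ : Finset G).filter (fun b => b ^ 3 = a ^ 3)).card : ℝ) ≤
      r * r + N * (δ * N) := by
    calc _ ≤ ∑ a : G, ((if a ^ 3 = 1 then (r : ℝ) else 0) + δ * N) := by
          refine sum_le_sum fun a _ => ?_
          split_ifs with hh
          · rw [hh]
            have : 0 ≤ δ * N := by positivity
            linarith
          · rw [zero_add]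
            refine le_trans ?_ (h1 _ hh)
            norm_cast
            refine card_le_card fun b hb => ?_
            simp only [mem_filter, mem_univ, true_and] at hb ⊢
            rw [← hb]; group
      _ = _ := by
          rw [sum_add_distrib, ← sum_filter, sum_const, sum_const, card_univ]
          simp [hr, hNdef]
  have s1 : ∑ g : G × G, (fixp 1 (tw g) : ℝ) = N ^ 2 := by exact_mod_cast sum_f1 (G := G)
  have s11 : ∑ g : G × G, (fixp 1 (tw g) : ℝ) ^ 2 ≤ N * (P * N) := by
    have : ∑ g : G × G, (fixp 1 (tw g) : ℝ) ^ 2 = N * ∑ h : G, (cz h : ℝ) := by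
      exact_mod_cast sum_f1sq (G := G)
    rw [this]; gcongr
  have s2 : ∑ g : G × G, (fixp 2 (tw g) : ℝ) ≤ N * (P * N) := by
    have : ∑ g : G × G, (fixp 2 (tw g) : ℝ) ≤ N * ∑ h : G, (cz h : ℝ) := by
      have := (sum_fi (G := G) 2).le.trans (Nat.mul_le_mul_left _ sum_sq_le)
      exact_mod_cast this
    exact this.trans (by gcongr)
  have s12 : ∑ g : G × G, (fixp 1 (tw g) : ℝ) * fixp 2 (tw g) ≤ N * (i2 * N + N * (δ * N)) := by
    have : ∑ g : G × G, (fixp 1 (tw g) : ℝ) * fixp 2 (tw g) = N * ∑ h : G, (cz (h ^ 2) : ℝ) := by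
      exact_mod_cast sum_f1f2 (G := G)
    rw [this]; gcongr
  have s3 : ∑ g : G × G, (fixp 3 (tw g) : ℝ) ≤ N * (r * r + N * (δ * N)) := by
    have : ∑ g : G × G, (fixp 3 (tw g) : ℝ) =
        N * ∑ a : G, (((univ : Finset G).filter (fun b => b ^ 3 = a ^ 3)).card : ℝ) := by
      exact_mod_cast sum_fi (G := G) 3
    rw [this]; gcongr
  have s111 : ∑ g : G × G with g ≠ 1, (fixp 1 (tw g) : ℝ) ^ 3 ≤ N * (δ * N ^ 2) := by
    have : ∑ g : G × G with g ≠ 1, (fixp 1 (tw g) : ℝ) ^ 3 =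
        N * ∑ h : G with h ≠ 1, (cz h : ℝ) ^ 2 := by
      exact_mod_cast sum_f1cube (G := G)
    rw [this]; gcongr
  have t0 : ∑ g : G × G with g ≠ 1, ((trip 0 (tw g)).card : ℝ) ≤
      N ^ 3 * (3 * δ + i2 / N + (r / N) ^ 2) := by
    calc _ ≤ ∑ g : G × G with g ≠ 1, ((fixp 1 (tw g) : ℝ) ^ 3 + fixp 1 (tw g) * fixp 2 (tw g)
            + fixp 3 (tw g)) := sum_le_sum fun g _ => by exact_mod_cast trip0 (tw g)
      _ = ∑ g : G × G with g ≠ 1, (fixp 1 (tw g) : ℝ) ^ 3 +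
            ∑ g : G × G with g ≠ 1, (fixp 1 (tw g) : ℝ) * fixp 2 (tw g) +
            ∑ g : G × G with g ≠ 1, (fixp 3 (tw g) : ℝ) := by
          rw [sum_add_distrib, sum_add_distrib]
      _ ≤ N * (δ * N ^ 2) + N * (i2 * N + N * (δ * N)) + N * (r * r + N * (δ * N)) := by
          refine add_le_add (add_le_add s111 ?_) ?_
          · exact (hsub _ fun g => by positivity).trans s12
          · exact (hsub _ fun g => by positivity).trans s3
      _ = _ := by field_simp; ring
  have t1 : ∑ g : G × G with g ≠ 1, ((trip 1 (tw g)).card : ℝ) ≤ N ^ 3 * (2 * P + 2) := by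
    refine (hsub _ fun g => by positivity).trans ?_
    calc _ ≤ ∑ g : G × G, ((fixp 1 (tw g) : ℝ) ^ 2 * N + fixp 1 (tw g) * N
            + fixp 2 (tw g) * N + N) := sum_le_sum fun g _ => by exact_mod_cast trip1 (tw g)
      _ = (∑ g : G × G, (fixp 1 (tw g) : ℝ) ^ 2) * N + (∑ g : G × G, (fixp 1 (tw g) : ℝ)) * N
            + (∑ g : G × G, (fixp 2 (tw g) : ℝ)) * N + N ^ 2 * N := by
          rw [sum_add_distrib, sum_add_distrib, sum_add_distrib, sum_mul, sum_mul, sum_mul,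
            sum_const, card_univ, Fintype.card_prod, nsmul_eq_mul]
          push_cast; rw [← hNdef]; ring
      _ ≤ (N * (P * N)) * N + N ^ 2 * N + (N * (P * N)) * N + N ^ 2 * N := by
          rw [s1]; gcongr
      _ = _ := by ring
  have t2 : ∑ g : G × G with g ≠ 1, ((trip 2 (tw g)).card : ℝ) ≤ N ^ 3 * (2 * N) := by
    refine (hsub _ fun g => by positivity).trans ?_
    calc _ ≤ ∑ g : G × G, ((fixp 1 (tw g) : ℝ) * N ^ 2 + N ^ 2) :=
          sum_le_sum fun g _ => by exact_mod_cast trip2 (tw g)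
      _ = N ^ 2 * N ^ 2 + N ^ 2 * N ^ 2 := by
          rw [sum_add_distrib, ← sum_mul, s1, 
            sum_const, card_univ, Fintype.card_prod, nsmul_eq_mul]
          push_cast; rw [← hNdef]; ring
      _ = _ := by ring
  have hch : (N : ℝ) ^ 3 ≤ 12 * N.choose 3 := by
    have e : (N.choose 3 : ℝ) * 6 = N * (N - 1) * (N - 2) := by
      obtain ⟨M, hM⟩ : ∃ M, N = M + 2 := ⟨N - 2, by omega⟩
      rw [hM]
      have e := Nat.choose_mul_factorial_mul_factorial (show 3 ≤ M + 3 by omega)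
      have h3 := Nat.descFactorial_eq_factorial_mul_choose (M + 2) 3
      have h4 : (M + 2).descFactorial 3 = (M + 2) * (M + 1) * M := by
        simp [Nat.descFactorial_succ]; ring
      rw [h4] at h3
      have : (((M + 2) * (M + 1) * M : ℕ) : ℝ) = ((Nat.factorial 3 * (M + 2).choose 3 : ℕ) : ℝ) := by
        rw [h3]
      simp only [Nat.factorial] at this
      push_cast at this ⊢
      linarith
    nlinarith [mul_nonneg hN0.le (mul_nonneg (sub_nonneg.2 hN6) hN0.le)]
  have hch0 : (0 : ℝ) < N.choose 3 := by
    have : (0 : ℝ) < N ^ 3 := by positivity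
    linarith
  set q : ℝ := k / N with hq
  have hq0 : 0 ≤ q := by positivity
  have hP0 : 0 ≤ P := by
    have : 0 ≤ P * N := le_trans (sum_nonneg fun h _ => by positivity) hP
    exact nonneg_of_mul_nonneg_left this hN0
  have hcount : ((((univ : Finset (G × G)).filter (fun g => g ≠ 1)).card : ℕ) : ℝ) ≤ N ^ 2 := by
    have := card_le_univ ((univ : Finset (G × G)).filter (fun g => g ≠ 1))
    rw [Fintype.card_prod, ← sq] at this
    exact_mod_cast this
  refine le_of_mul_le_mul_right ?_ hch0
  calc (∑ g : G × G with g ≠ 1, (fixk k (tw g) : ℝ)) * N.choose 3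
      = ∑ g : G × G with g ≠ 1, (fixk k (tw g) : ℝ) * N.choose 3 := by rw [sum_mul]
    _ ≤ ∑ g : G × G with g ≠ 1, (N.choose k : ℝ) * ((trip 0 (tw g)).card +
          q * (trip 1 (tw g)).card + q ^ 2 * (trip 2 (tw g)).card + q ^ 3 * N.choose 3) :=
        sum_le_sum fun g _ => regime1 (tw g) k hk3 hk q hq
    _ = (N.choose k : ℝ) * (∑ g : G × G with g ≠ 1, ((trip 0 (tw g)).card : ℝ) +
          q * (∑ g : G × G with g ≠ 1, ((trip 1 (tw g)).card : ℝ)) +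
          q ^ 2 * (∑ g : G × G with g ≠ 1, ((trip 2 (tw g)).card : ℝ)) +
          q ^ 3 * N.choose 3 * (((univ : Finset (G × G)).filter (fun g => g ≠ 1)).card)) := by
        rw [← mul_sum, sum_add_distrib, sum_add_distrib, sum_add_distrib, mul_sum, mul_sum,
          sum_const, nsmul_eq_mul]
        ring
    _ ≤ (N.choose k : ℝ) * (N ^ 3 * (3 * δ + i2 / N + (r / N) ^ 2) +
          q * (N ^ 3 * (2 * P + 2)) + q ^ 2 * (N ^ 3 * (2 * N)) +
          q ^ 3 * (12 * N.choose 3) * N ^ 2) := by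
        have : (N.choose 3 : ℝ) ≤ 12 * N.choose 3 := by linarith
        gcongr
    _ ≤ (N.choose k : ℝ) * ((12 * N.choose 3) * (3 * δ + i2 / N + (r / N) ^ 2) +
          q * ((12 * N.choose 3) * (2 * P + 2)) + q ^ 2 * ((12 * N.choose 3) * (2 * N)) +
          q ^ 3 * (12 * N.choose 3) * N ^ 2) := by
        gcongr
    _ = _ := by
        rw [hq]; field_simp
end grp

theorem cz_factorial {n : ℕ} (h : Perm (Fin n)) (m : ℕ) (hm : 3 * m ≤ h.support.card) :
    cz h * m.factorial ≤ n.factorial := by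
  obtain ⟨A, hA, hAc⟩ := exists_disj h
  have hmA : m ≤ A.card := by omega
  have hAn : A.card ≤ n := by simpa using card_le_univ A
  set B := A.image h with hB
  have hBc : B.card = A.card := card_image_of_injective _ h.injective
  have hle : cz h ≤ Fintype.card ({x // x ∉ B} ↪ Fin n) := by
    unfold cz
    rw [← card_univ]
    refine card_le_card_of_injOn
      (fun u => (Function.Embedding.subtype _).trans u.toEmbedding) (fun _ _ => by simp) ?_
    intro u hu v hv huv
    simp only [coe_filter, mem_univ, true_and, Set.mem_ofPred_eq] at hu hv
    have key : ∀ x, x ∉ B → u x = v x := fun x hx =>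
      congrArg (fun f : {x // x ∉ B} ↪ Fin n => f ⟨x, hx⟩) huv
    ext1 x
    by_cases hx : x ∈ B
    · obtain ⟨a, ha, rfl⟩ := mem_image.1 hx
      have e1 : u (h a) = h (u a) := (congrArg (fun f : Perm (Fin n) => f a) hu).symm
      have e2 : v (h a) = h (v a) := (congrArg (fun f : Perm (Fin n) => f a) hv).symm
      rw [e1, e2, key a (Finset.disjoint_left.1 hA ha)]
    · exact key x hx
  have hc : Fintype.card {x // x ∉ B} = n - A.card := by
    rw [Fintype.card_subtype_compl, Fintype.card_fin, Fintype.card_coe, hBc]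
  rw [Fintype.card_embedding_eq, hc, Fintype.card_fin] at hle
  have hf := Nat.factorial_mul_descFactorial (n := n) (k := n - A.card) (by omega)
  rw [Nat.sub_sub_self hAn] at hf
  calc cz h * m.factorial ≤ n.descFactorial (n - A.card) * A.card.factorial :=
        Nat.mul_le_mul hle (Nat.factorial_le hmA)
    _ = _ := by rw [mul_comm]; exact hf

theorem exists_perm_image {n : ℕ} (S A : Finset (Fin n)) (h : S.card = A.card) :
    ∃ σ : Perm (Fin n), S.image σ = A := by
  let e : {x // x ∈ S} ≃ {x // x ∈ A} := Finset.equivOfCardEq h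
  refine ⟨e.extendSubtype, ?_⟩
  apply eq_of_subset_of_card_le
  · intro y hy
    obtain ⟨x, hx, rfl⟩ := mem_image.1 hy
    exact e.extendSubtype_mem x hx
  · rw [card_image_of_injective _ (Equiv.injective _), h]

theorem cz_choose {n : ℕ} (h : Perm (Fin n)) :
    cz h * n.choose h.support.card ≤ n.factorial := by
  classical
  have hex : ∀ A : Finset (Fin n), ∃ σ : Perm (Fin n), A.card = h.support.card →
      h.support.image σ = A := by
    intro A
    by_cases hc : A.card = h.support.card
    · obtain ⟨σ, hσ⟩ := exists_perm_image h.support A hc.symm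
      exact ⟨σ, fun _ => hσ⟩
    · exact ⟨1, fun h => absurd h hc⟩
  choose σ hσ using hex
  have h1 : n.choose h.support.card = (powersetCard h.support.card (univ : Finset (Fin n))).card := by
    rw [card_powersetCard, card_univ, Fintype.card_fin]
  have h2 : n.factorial = (univ : Finset (Perm (Fin n))).card := by
    rw [card_univ, Fintype.card_perm, Fintype.card_fin]
  rw [h1, h2, cz, ← card_product]
  refine card_le_card_of_injOn (fun p => σ p.2 * p.1) (fun _ _ => by simp) ?_
  rintro ⟨u, A⟩ hu ⟨v, B⟩ hv huv
  simp only [coe_product, coe_filter, Set.mem_prod, mem_univ, true_and, Set.mem_ofPred_eq, mem_coe,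
    mem_powersetCard, subset_univ] at hu hv huv
  have himg : ∀ w : Perm (Fin n), h * w = w * h → h.support.image w = h.support := by
    intro w hw
    apply eq_of_subset_of_card_le
    · intro y hy
      obtain ⟨x, hx, rfl⟩ := mem_image.1 hy
      rw [Perm.mem_support] at hx ⊢
      have e : h (w x) = w (h x) := congrArg (fun f : Perm (Fin n) => f x) hw
      rw [e]
      exact fun h' => hx (w.injective h')
    · rw [card_image_of_injective _ w.injective]
  have hAB : A = B := by
    have e1 : h.support.image (σ A * u) = A := by
      rw [Perm.coe_mul, ← image_image, himg u hu.1, hσ A hu.2]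
    have e2 : h.support.image (σ B * v) = B := by
      rw [Perm.coe_mul, ← image_image, himg v hv.1, hσ B hv.2]
    rw [← e1, ← e2, huv]
  subst hAB
  rw [mul_right_inj] at huv
  rw [huv]

theorem class_sum {n : ℕ} (c : Multiset ℕ) :
    ∑ h : Perm (Fin n) with h.cycleType = c, cz h ≤ n.factorial := by
  rcases ((univ : Finset (Perm (Fin n))).filter (fun h => h.cycleType = c)).eq_empty_or_nonempty
    with h | ⟨h0, hh0⟩
  · rw [h]; simp
  have h2 : n.factorial = (univ : Finset (Perm (Fin n))).card := by
    rw [card_univ, Fintype.card_perm, Fintype.card_fin]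
  rw [h2]
  have hh0 := (mem_filter.1 hh0).2
  rw [card_eq_sum_card_fiberwise (f := fun g => g * h0 * g⁻¹)
    (t := (univ : Finset (Perm (Fin n))).filter (fun h => h.cycleType = c))]
  · refine sum_le_sum fun h hh => ?_
    have hh := (mem_filter.1 hh).2
    have hc : IsConj h0 h := Perm.isConj_iff_cycleType_eq.2 (hh0.trans hh.symm)
    obtain ⟨g, hg⟩ := isConj_iff.1 hc
    unfold cz
    refine card_le_card_of_injOn (fun u => u * g) ?_ ?_
    · intro u hu
      simp only [coe_filter, mem_univ, true_and, Set.mem_ofPred_eq] at hu ⊢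
      calc u * g * h0 * (u * g)⁻¹ = u * (g * h0 * g⁻¹) * u⁻¹ := by group
        _ = h := by rw [hg, ← hu]; group
    · intro u _ v _ huv
      simpa using huv
  · intro g _
    simp only [coe_filter, mem_univ, true_and, Set.mem_ofPred_eq]
    rw [← hh0, Perm.cycleType_conj]

theorem supp_sum {n : ℕ} (s : ℕ) :
    ∑ h : Perm (Fin n) with h.support.card = s, cz h ≤ 2 ^ s * n.factorial := by
  classical
  set S := (univ : Finset (Perm (Fin n))).filter (fun h => h.support.card = s) with hS
  have h1 : ∑ h ∈ S, cz h = ∑ c ∈ S.image Perm.cycleType, ∑ h ∈ S with h.cycleType = c, cz h := by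
    rw [sum_fiberwise_of_maps_to]
    intro h hh
    exact mem_image_of_mem _ hh
  have hcard : (S.image Perm.cycleType).card ≤ 2 ^ s := by
    have hsub : S.image Perm.cycleType ⊆ (univ : Finset (Nat.Partition s)).image Nat.Partition.parts := by
      intro c hc
      obtain ⟨h, hh, rfl⟩ := mem_image.1 hc
      have hh := (mem_filter.1 hh).2
      refine mem_image.2 ⟨⟨h.cycleType, ?_, ?_⟩, mem_univ _, rfl⟩
      · intro i hi; exact lt_trans Nat.zero_lt_one (Perm.one_lt_of_mem_cycleType hi)
      · rw [Perm.sum_cycleType, hh]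
    calc _ ≤ _ := card_le_card hsub
      _ ≤ (univ : Finset (Nat.Partition s)).card := card_image_le
      _ = Fintype.card (Nat.Partition s) := rfl
      _ ≤ Fintype.card (Composition s) :=
          Fintype.card_le_of_surjective _ Nat.Partition.ofComposition_surj
      _ = 2 ^ (s - 1) := composition_card s
      _ ≤ 2 ^ s := Nat.pow_le_pow_right (by norm_num) (by omega)
  rw [h1]
  calc _ ≤ ∑ c ∈ S.image Perm.cycleType, n.factorial := by
        refine sum_le_sum fun c _ => le_trans ?_ (class_sum c)
        exact sum_le_sum_of_subset (filter_subset_filter _ (filter_subset _ _))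
    _ = (S.image Perm.cycleType).card * n.factorial := by rw [sum_const, smul_eq_mul]
    _ ≤ _ := Nat.mul_le_mul_right _ hcard

theorem sum_by_supp {n : ℕ} {M : Type*} [AddCommMonoid M] (f : Perm (Fin n) → M) :
    ∑ h : Perm (Fin n), f h = ∑ s ∈ range (n + 1), ∑ h : Perm (Fin n) with h.support.card = s, f h := by
  rw [sum_fiberwise_of_maps_to]
  intro h _
  have := card_le_univ h.support
  rw [Fintype.card_fin] at this
  rw [mem_range]; omega

theorem total_cz {n : ℕ} : ∑ h : Perm (Fin n), cz h ≤ 2 ^ (n + 1) * n.factorial := by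
  rw [sum_by_supp]
  calc _ ≤ ∑ s ∈ range (n + 1), 2 ^ s * n.factorial := sum_le_sum fun s _ => supp_sum s
    _ = (∑ s ∈ range (n + 1), 2 ^ s) * n.factorial := by rw [sum_mul]
    _ ≤ _ := by
      apply Nat.mul_le_mul_right
      have := Nat.geomSum_lt (m := 2) (n := n + 1) (s := range (n + 1)) le_rfl (fun k hk => mem_range.1 hk)
      exact this.le

theorem choose_lower {n : ℕ} (s : ℕ) (hs : 5 * (s + 2) ≤ n) :
    n.choose 2 * 4 ^ s ≤ n.choose (s + 2) := by
  induction s with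
  | zero => simp
  | succ s ih =>
    have ih := ih (by omega)
    have e := Nat.choose_succ_right_eq n (s + 2)
    have h4 : 4 * (s + 2 + 1) ≤ n - (s + 2) := by omega
    refine Nat.le_of_mul_le_mul_right (c := s + 2 + 1) ?_ (by omega)
    calc n.choose 2 * 4 ^ (s + 1) * (s + 2 + 1) = (n.choose 2 * 4 ^ s) * (4 * (s + 2 + 1)) := by ring
      _ ≤ n.choose (s + 2) * (n - (s + 2)) := Nat.mul_le_mul ih h4
      _ = n.choose (s + 2 + 1) * (s + 2 + 1) := e.symm
      _ = _ := by rw [show s + 1 + 2 = s + 2 + 1 by ring]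

theorem two_le_supp {n : ℕ} {h : Perm (Fin n)} (hh : h ≠ 1) : 2 ≤ h.support.card :=
  Perm.two_le_card_support_of_ne_one hh

/-- the error parameter -/
noncomputable def dl (n : ℕ) : ℝ := 32 / (n : ℝ) ^ 2 + 2 ^ (n + 1) / ((n / 15).factorial : ℝ)

theorem choose2_lower {n : ℕ} (hn : 2 ≤ n) : (n : ℝ) ^ 2 ≤ 4 * n.choose 2 := by
  rw [Nat.cast_choose_two]
  have : (2 : ℝ) ≤ n := by exact_mod_cast hn
  nlinarith

theorem cz_small {n : ℕ} (s : ℕ) (h : Perm (Fin n)) (hs : h.support.card = s + 2)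
    (h5 : 5 * (s + 2) ≤ n) : (cz h : ℝ) ≤ (4 / (n : ℝ) ^ 2) * (1 / 4) ^ s * n.factorial := by
  have h1 := cz_choose h
  rw [hs] at h1
  have h2 := (Nat.mul_le_mul_left (cz h) (choose_lower s h5)).trans h1
  have h2' : (cz h : ℝ) * (n.choose 2 * 4 ^ s) ≤ n.factorial := by exact_mod_cast h2
  have h3 := choose2_lower (n := n) (by omega)
  have hn : (0 : ℝ) < n := by exact_mod_cast (by omega : 0 < n)
  rw [one_div_pow, div_mul_eq_mul_div, div_mul_eq_mul_div, le_div_iff₀ (by positivity)]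
  have : (cz h : ℝ) * n ^ 2 * 4 ^ s ≤ 4 * n.factorial := by
    calc (cz h : ℝ) * n ^ 2 * 4 ^ s ≤ cz h * (4 * n.choose 2) * 4 ^ s := by gcongr
      _ = 4 * ((cz h : ℝ) * (n.choose 2 * 4 ^ s)) := by ring
      _ ≤ _ := by gcongr
  rw [mul_one_div, div_mul_eq_mul_div, le_div_iff₀ (by positivity)]
  exact this

theorem cz_large {n : ℕ} (h : Perm (Fin n)) (h5 : n < 5 * h.support.card) :
    (cz h : ℝ) ≤ n.factorial / ((n / 15).factorial : ℝ) := by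
  rw [le_div_iff₀ (by positivity)]
  exact_mod_cast cz_factorial h (n / 15) (by omega)

theorem cz_dl {n : ℕ} (h : Perm (Fin n)) (hh : h ≠ 1) : (cz h : ℝ) ≤ dl n * n.factorial := by
  have h2 := two_le_supp hh
  have hn : 0 < n := by
    have := card_le_univ h.support
    rw [Fintype.card_fin] at this; omega
  have hn' : (0 : ℝ) < n := by exact_mod_cast hn
  by_cases h5 : 5 * h.support.card ≤ n
  · obtain ⟨s, hs⟩ := Nat.exists_eq_add_of_le' h2
    refine (cz_small s h hs (by omega)).trans ?_
    have h1 : (1 / 4 : ℝ) ^ s ≤ 1 := pow_le_one₀ (by norm_num) (by norm_num)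
    have h2 : 4 / (n : ℝ) ^ 2 * (1 / 4) ^ s ≤ dl n := by
      unfold dl
      have : 4 / (n : ℝ) ^ 2 * (1 / 4) ^ s ≤ 4 / (n : ℝ) ^ 2 * 1 := by gcongr
      have h3 : 4 / (n : ℝ) ^ 2 * 1 ≤ 32 / (n : ℝ) ^ 2 := by
        rw [mul_one]; gcongr; norm_num
      have : (0 : ℝ) ≤ 2 ^ (n + 1) / ((n / 15).factorial : ℝ) := by positivity
      linarith
    gcongr
  · refine (cz_large h (by omega)).trans ?_
    rw [div_eq_mul_one_div, mul_comm]
    have : 1 / ((n / 15).factorial : ℝ) ≤ dl n := by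
      unfold dl
      have h3 : 1 / ((n / 15).factorial : ℝ) ≤ 2 ^ (n + 1) / ((n / 15).factorial : ℝ) := by
        gcongr; exact one_le_pow₀ (by norm_num)
      have : (0 : ℝ) ≤ 32 / (n : ℝ) ^ 2 := by positivity
      linarith
    gcongr

theorem sumsq_dl {n : ℕ} (hn : 1 ≤ n) :
    ∑ h : Perm (Fin n) with h ≠ 1, (cz h : ℝ) ^ 2 ≤ dl n * (n.factorial : ℝ) ^ 2 := by
  have hn' : (0 : ℝ) < n := by exact_mod_cast hn
  set N : ℝ := (n.factorial : ℝ) with hN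
  have hN0 : 0 < N := by positivity
  -- split
  have hsplit : ∀ h : Perm (Fin n), h ≠ 1 → (cz h : ℝ) ^ 2 ≤
      (∑ s ∈ range n, if h.support.card = s + 2 then
        (4 / (n : ℝ) ^ 2) * (1 / 4) ^ s * N * cz h else 0) +
      N / ((n / 15).factorial : ℝ) * cz h := by
    intro h hh
    have h2 := two_le_supp hh
    have hsn : h.support.card ≤ n := by
      have := card_le_univ h.support
      rwa [Fintype.card_fin] at this
    by_cases h5 : 5 * h.support.card ≤ n
    · obtain ⟨s, hs⟩ := Nat.exists_eq_add_of_le' h2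
      have h1 := cz_small s h hs (by omega)
      have hsum : (4 / (n : ℝ) ^ 2) * (1 / 4) ^ s * N * cz h ≤
          ∑ s ∈ range n, if h.support.card = s + 2 then
            (4 / (n : ℝ) ^ 2) * (1 / 4) ^ s * N * cz h else 0 := by
        have := single_le_sum (f := fun s => if h.support.card = s + 2 then
            (4 / (n : ℝ) ^ 2) * (1 / 4) ^ s * N * cz h else 0) (s := range n)
            (fun i _ => by split_ifs <;> positivity) (mem_range.2 (by omega : s < n))
        simpa [hs] using this
      have h0 : 0 ≤ N / ((n / 15).factorial : ℝ) * cz h := by positivity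
      have : (cz h : ℝ) ^ 2 ≤ (4 / (n : ℝ) ^ 2) * (1 / 4) ^ s * N * cz h := by
        rw [sq]; gcongr
      linarith
    · have h1 := cz_large h (by omega)
      have h0 : (0 : ℝ) ≤ ∑ s ∈ range n, if h.support.card = s + 2 then
            (4 / (n : ℝ) ^ 2) * (1 / 4) ^ s * N * cz h else 0 :=
        sum_nonneg fun i _ => by split_ifs <;> positivity
      have : (cz h : ℝ) ^ 2 ≤ N / ((n / 15).factorial : ℝ) * cz h := by
        rw [sq]; gcongr
      linarith
  have htot : ∑ h : Perm (Fin n), (cz h : ℝ) ≤ 2 ^ (n + 1) * N := by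
    rw [hN]; exact_mod_cast total_cz (n := n)
  have hsupp : ∀ s, ∑ h : Perm (Fin n) with h.support.card = s, (cz h : ℝ) ≤ 2 ^ s * N := by
    intro s; rw [hN]; exact_mod_cast supp_sum (n := n) s
  calc ∑ h : Perm (Fin n) with h ≠ 1, (cz h : ℝ) ^ 2
      ≤ ∑ h : Perm (Fin n) with h ≠ 1, ((∑ s ∈ range n, if h.support.card = s + 2 then
        (4 / (n : ℝ) ^ 2) * (1 / 4) ^ s * N * cz h else 0) +
      N / ((n / 15).factorial : ℝ) * cz h) := sum_le_sum fun h hh => hsplit h (mem_filter.1 hh).2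
    _ ≤ ∑ h : Perm (Fin n), ((∑ s ∈ range n, if h.support.card = s + 2 then
        (4 / (n : ℝ) ^ 2) * (1 / 4) ^ s * N * cz h else 0) +
      N / ((n / 15).factorial : ℝ) * cz h) := by
        refine sum_le_sum_of_subset_of_nonneg (filter_subset _ _) fun h _ _ => ?_
        refine add_nonneg (sum_nonneg fun i _ => by split_ifs <;> positivity) (by positivity)
    _ = (∑ s ∈ range n, (4 / (n : ℝ) ^ 2) * (1 / 4) ^ s * N *
          ∑ h : Perm (Fin n) with h.support.card = s + 2, (cz h : ℝ)) +
        N / ((n / 15).factorial : ℝ) * ∑ h : Perm (Fin n), (cz h : ℝ) := by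
        rw [sum_add_distrib, sum_comm, mul_sum]
        congr 1
        refine sum_congr rfl fun s _ => ?_
        rw [mul_sum, sum_filter]
    _ ≤ (∑ s ∈ range n, (4 / (n : ℝ) ^ 2) * (1 / 4) ^ s * N * (2 ^ (s + 2) * N)) +
        N / ((n / 15).factorial : ℝ) * (2 ^ (n + 1) * N) := by
        gcongr with s _
        exact hsupp _
    _ = (16 / (n : ℝ) ^ 2) * N ^ 2 * (∑ s ∈ range n, (1 / 2 : ℝ) ^ s) +
        2 ^ (n + 1) / ((n / 15).factorial : ℝ) * N ^ 2 := by
        congr 1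
        · rw [mul_sum]
          refine sum_congr rfl fun s _ => ?_
          have : (1 / 2 : ℝ) ^ s = (1 / 4) ^ s * 2 ^ s := by rw [← mul_pow]; norm_num
          rw [this]; ring
        · ring
    _ ≤ (16 / (n : ℝ) ^ 2) * N ^ 2 * 2 + 2 ^ (n + 1) / ((n / 15).factorial : ℝ) * N ^ 2 := by
        gcongr
        have := geom_sum_Ico_le_of_lt_one (x := (1 / 2 : ℝ)) (m := 0) (n := n) (by norm_num) (by norm_num)
        rw [← range_eq_Ico] at this
        norm_num at this ⊢
        exact this
    _ = _ := by unfold dl; ring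

theorem cube_roots {n : ℕ} (hn : 1 ≤ n) :
    ((univ : Finset (Perm (Fin n))).filter (fun b => b ^ 3 = 1)).card * (n - 3) ≤ 3 * n.factorial := by
  classical
  obtain ⟨o⟩ : Nonempty (Fin n) := ⟨⟨0, hn⟩⟩
  set R := (univ : Finset (Perm (Fin n))).filter (fun b => b ^ 3 = 1) with hR
  set Q : Finset (Perm (Fin n) × Fin n) := R.biUnion (fun h =>
    (({o, h o, h (h o)} : Finset (Fin n))ᶜ).image (fun i => (h, i))) with hQ
  have hmem : ∀ p, p ∈ Q ↔ p.1 ^ 3 = 1 ∧ p.2 ≠ o ∧ p.2 ≠ p.1 o ∧ p.2 ≠ p.1 (p.1 o) := by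
    rintro ⟨h, i⟩
    simp only [hQ, mem_biUnion, hR, mem_filter, mem_univ, true_and, mem_image, mem_compl,
      mem_insert, mem_singleton, not_or, Prod.mk.injEq]
    constructor
    · rintro ⟨h', h1, i', h2, rfl, rfl⟩; exact ⟨h1, h2⟩
    · rintro ⟨h1, h2⟩; exact ⟨h, h1, i, h2, rfl, rfl⟩
  have hQc : R.card * (n - 3) ≤ Q.card := by
    rw [hQ, card_biUnion]
    · rw [← smul_eq_mul, ← sum_const]
      refine sum_le_sum fun h _ => ?_
      rw [card_image_of_injective _ (fun i j hij => by simpa using hij), card_compl, Fintype.card_fin]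
      have := card_le_three (a := o) (b := h o) (c := h (h o))
      omega
    · intro h _ h' _ hne
      rw [Function.onFun, Finset.disjoint_left]
      rintro ⟨a, b⟩ h1 h2
      simp only [mem_image, Prod.mk.injEq] at h1 h2
      obtain ⟨_, _, rfl, _⟩ := h1
      obtain ⟨_, _, rfl, _⟩ := h2
      exact hne rfl
  refine hQc.trans ?_
  -- each w has at most 3 preimages
  have hmaps : Q ⊆ (univ : Finset (Perm (Fin n))).biUnion (fun w =>
      ({w o, w (w o), w (w (w o))} : Finset (Fin n)).image (fun i => (w * swap o i, i))) := by
    rintro ⟨h, i⟩ hp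
    rw [hmem] at hp
    obtain ⟨h3, hi0, hi1, hi2⟩ := hp
    dsimp only at h3 hi0 hi1 hi2
    have h3' : ∀ x, h (h (h x)) = x := fun x => by
      have := congrArg (fun f : Perm (Fin n) => f x) h3
      simpa [pow_succ] using this
    rw [mem_biUnion]
    refine ⟨h * swap o i, mem_univ _, mem_image.2 ⟨i, ?_, ?_⟩⟩
    · simp only [mem_insert, mem_singleton]
      have e1 : (h * swap o i) o = h i := by simp
      rw [e1]
      by_cases c1 : h i = i
      · left; exact c1.symm
      · have n1 : h i ≠ o := fun hc => hi2 (by rw [← hc, h3'])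
        have e2 : (h * swap o i) (h i) = h (h i) := by
          rw [Perm.mul_apply, swap_apply_of_ne_of_ne n1 c1]
        rw [e2]
        have n2 : h (h i) ≠ o := fun hc => hi1 (by rw [← hc, h3'])
        have c2 : h (h i) ≠ i := fun hc => c1 (by
          have := h3' i
          rw [hc] at this
          exact this)
        have e3 : (h * swap o i) (h (h i)) = i := by
          rw [Perm.mul_apply, swap_apply_of_ne_of_ne n2 c2, h3']
        rw [e3]; right; right; rfl
    · rw [mul_assoc, swap_mul_self, mul_one]
  calc Q.card ≤ _ := card_le_card hmaps
    _ ≤ ∑ w : Perm (Fin n), 3 := by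
      refine card_biUnion_le.trans (sum_le_sum fun w _ => card_image_le.trans card_le_three)
    _ = _ := by rw [sum_const, card_univ, Fintype.card_perm, Fintype.card_fin, smul_eq_mul, mul_comm]

theorem ev_fact : ∀ᶠ n : ℕ in Filter.atTop, 4 ^ (n + 1) ≤ (n / 15).factorial := by
  have h := (FloorSemiring.tendsto_pow_div_factorial_atTop ((4 : ℝ) ^ 15)).eventually_le_const
    (u := 1 / (4 : ℝ) ^ 16) (by positivity)
  have h15 : Filter.Tendsto (fun n : ℕ => n / 15) Filter.atTop Filter.atTop :=
    Nat.tendsto_div_const_atTop (by norm_num)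
  filter_upwards [h15.eventually h] with n hn
  rw [div_le_div_iff₀ (by positivity) (by positivity)] at hn
  have h1 : 4 ^ (n + 1) ≤ (4 ^ 15) ^ (n / 15) * 4 ^ 16 := by
    rw [← pow_mul, ← pow_add]
    exact Nat.pow_le_pow_right (by norm_num) (by omega)
  have h2 : (4 ^ 15) ^ (n / 15) * 4 ^ 16 ≤ (n / 15).factorial := by
    have : ((4 : ℝ) ^ 15) ^ (n / 15) * 4 ^ 16 ≤ ((n / 15).factorial : ℝ) := by linarith
    exact_mod_cast this
  exact h1.trans h2

theorem ev_pow : ∀ᶠ n : ℕ in Filter.atTop, (n : ℝ) ^ 11 ≤ 2 ^ (n + 1) := by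
  have h := (tendsto_pow_const_div_const_pow_of_one_lt 11 (r := 2) (by norm_num)).eventually_le_const
    (u := 1) (by norm_num)
  filter_upwards [h] with n hn
  rw [div_le_one (by positivity)] at hn
  refine hn.trans ?_
  rw [pow_succ]
  have : (0 : ℝ) < 2 ^ n := by positivity
  linarith

theorem ev_exp (n : ℕ) (hn : 36 ≤ n) (k : ℕ) (hk : n ^ 3 ≤ k) :
    (n.factorial : ℝ) ^ 2 * ((n.factorial + 1) * Real.exp (-(k / 6))) ≤ 1 / (n : ℝ) ^ 2 := by
  have hn0 : (36 : ℝ) ≤ n := by exact_mod_cast hn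
  have hne : (n : ℝ) ≤ Real.exp n := by have := Real.add_one_le_exp (n : ℝ); linarith
  have hN : (n.factorial : ℝ) ≤ Real.exp ((n : ℝ) ^ 2) := by
    calc (n.factorial : ℝ) ≤ (n : ℝ) ^ n := by exact_mod_cast Nat.factorial_le_pow n
      _ ≤ (Real.exp n) ^ n := by gcongr
      _ = _ := by rw [← Real.exp_nat_mul, sq]
  have h1 : (1 : ℝ) ≤ n.factorial := by exact_mod_cast Nat.factorial_pos n
  have he : (2 : ℝ) ≤ Real.exp 1 := by have := Real.add_one_le_exp (1 : ℝ); linarith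
  have hN1 : (n.factorial : ℝ) + 1 ≤ Real.exp 1 * Real.exp ((n : ℝ) ^ 2) := by
    calc (n.factorial : ℝ) + 1 ≤ 2 * n.factorial := by linarith
      _ ≤ _ := by gcongr
  have hk' : (n : ℝ) ^ 3 ≤ k := by exact_mod_cast hk
  rw [le_div_iff₀ (by positivity)]
  calc (n.factorial : ℝ) ^ 2 * ((n.factorial + 1) * Real.exp (-(k / 6))) * (n : ℝ) ^ 2
      ≤ (Real.exp ((n : ℝ) ^ 2)) ^ 2 * ((Real.exp 1 * Real.exp ((n : ℝ) ^ 2)) *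
          Real.exp (-((n : ℝ) ^ 3 / 6))) * (Real.exp n) ^ 2 := by gcongr
    _ = Real.exp (2 * (n : ℝ) ^ 2 + (1 + (n : ℝ) ^ 2 + -((n : ℝ) ^ 3 / 6)) + 2 * n) := by
        rw [Real.exp_add, Real.exp_add, Real.exp_add, Real.exp_add, ← Real.exp_nat_mul,
          ← Real.exp_nat_mul]
        norm_num
    _ ≤ Real.exp 0 := by
        apply Real.exp_le_exp.2
        nlinarith [mul_nonneg (sq_nonneg (n : ℝ)) (sub_nonneg.2 hn0)]
    _ = 1 := Real.exp_zero

theorem dl_le (n : ℕ) (hn : 1 ≤ n) (hf : 4 ^ (n + 1) ≤ (n / 15).factorial)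
    (hp : (n : ℝ) ^ 11 ≤ 2 ^ (n + 1)) : dl n ≤ 33 / (n : ℝ) ^ 2 := by
  have hn' : (1 : ℝ) ≤ n := by exact_mod_cast hn
  have hf' : (4 : ℝ) ^ (n + 1) ≤ ((n / 15).factorial : ℝ) := by exact_mod_cast hf
  have h4 : (4 : ℝ) ^ (n + 1) = 2 ^ (n + 1) * 2 ^ (n + 1) := by rw [← mul_pow]; norm_num
  have : (2 : ℝ) ^ (n + 1) / ((n / 15).factorial : ℝ) ≤ 1 / (n : ℝ) ^ 2 := by
    rw [div_le_div_iff₀ (by positivity) (by positivity), one_mul]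
    refine le_trans ?_ hf'
    rw [h4]
    gcongr
    exact (pow_le_pow_right₀ hn' (by norm_num)).trans hp
  unfold dl
  calc _ ≤ 32 / (n : ℝ) ^ 2 + 1 / (n : ℝ) ^ 2 := by gcongr
    _ = _ := by ring

theorem reg1 (n : ℕ) (hn : 36 ≤ n) (hf : 4 ^ (n + 1) ≤ (n / 15).factorial)
    (hp : (n : ℝ) ^ 11 ≤ 2 ^ (n + 1)) (k : ℕ) (hk3 : 3 ≤ k) (hkN : k ≤ n.factorial)
    (hk : k ≤ n ^ 3) :
    ∑ g : Perm (Fin n) × Perm (Fin n) with g ≠ 1, (fixk k (tw g) : ℝ) ≤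
      n.factorial.choose k * (2000 / (n : ℝ) ^ 2) := by
  have hn' : (36 : ℝ) ≤ n := by exact_mod_cast hn
  have hn1 : (1 : ℝ) ≤ n := by linarith
  have hcard : Fintype.card (Perm (Fin n)) = n.factorial := by
    rw [Fintype.card_perm, Fintype.card_fin]
  have hdl := dl_le n (by omega) hf hp
  have hdl0 : 0 ≤ dl n := by unfold dl; positivity
  have hNN : 4 ^ (n + 1) ≤ n.factorial := hf.trans (Nat.factorial_le (Nat.div_le_self _ _))
  have h4 : (4 : ℝ) ^ (n + 1) = 2 ^ (n + 1) * 2 ^ (n + 1) := by rw [← mul_pow]; norm_num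
  have hN4 : (2 : ℝ) ^ (n + 1) * 2 ^ (n + 1) ≤ (n.factorial : ℝ) := by
    rw [← h4]; exact_mod_cast hNN
  have hN6 : 6 ≤ n.factorial := le_trans (by decide) (Nat.factorial_le (by omega : 3 ≤ n))
  have key := group_bound (G := Perm (Fin n)) (dl n) (2 ^ (n + 1)) hdl0 (by rw [hcard]; exact hN6)
    (fun h hh => by rw [hcard]; exact cz_dl h hh) (by rw [hcard]; exact sumsq_dl (by omega))
    (by rw [hcard]; exact_mod_cast total_cz (n := n)) k hk3 (by rw [hcard]; exact hkN)
  rw [hcard] at key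
  refine key.trans ?_
  have hi := invol_sq_le (G := Perm (Fin n))
  have htot := total_cz (n := n)
  have hc := cube_roots (n := n) (by omega)
  set i2 := ((univ : Finset (Perm (Fin n))).filter (fun b => b ^ 2 = 1)).card
  set i3 := ((univ : Finset (Perm (Fin n))).filter (fun b => b ^ 3 = 1)).card
  have hi' : (i2 : ℝ) ^ 2 ≤ 2 ^ (n + 1) * (n.factorial : ℝ) := by
    exact_mod_cast hi.trans htot
  have hc' : (i3 : ℝ) * ((n : ℝ) - 3) ≤ 3 * (n.factorial : ℝ) := by
    have : ((n - 3 : ℕ) : ℝ) = (n : ℝ) - 3 := by rw [Nat.cast_sub (by omega)]; norm_num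
    rw [← this]; exact_mod_cast hc
  have hkr : (k : ℝ) ≤ (n : ℝ) ^ 3 := by exact_mod_cast hk
  have hNpos : (0 : ℝ) < (n.factorial : ℝ) := by positivity
  set N : ℝ := (n.factorial : ℝ)
  set Q : ℝ := (2 : ℝ) ^ (n + 1)
  have hQ1 : 1 ≤ Q := one_le_pow₀ (by norm_num)
  have hnn : (0 : ℝ) < (n : ℝ) ^ 2 := by positivity
  have e1 : 3 * dl n ≤ 99 / (n : ℝ) ^ 2 := by
    calc 3 * dl n ≤ 3 * (33 / (n : ℝ) ^ 2) := by gcongr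
      _ = _ := by ring
  have e2 : (i2 : ℝ) / N ≤ 1 / (n : ℝ) ^ 2 := by
    rw [div_le_div_iff₀ hNpos hnn, one_mul]
    refine abs_le_of_sq_le_sq' ?_ hNpos.le |>.2
    have h4 : (n : ℝ) ^ 4 ≤ Q := (pow_le_pow_right₀ hn1 (by norm_num)).trans hp
    calc ((i2 : ℝ) * (n : ℝ) ^ 2) ^ 2 = (i2 : ℝ) ^ 2 * (n : ℝ) ^ 4 := by ring
      _ ≤ (Q * N) * Q := by gcongr
      _ = (Q * Q) * N := by ring
      _ ≤ N * N := by gcongr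
      _ = N ^ 2 := by ring
  have e3 : ((i3 : ℝ) / N) ^ 2 ≤ 36 / (n : ℝ) ^ 2 := by
    have : (i3 : ℝ) / N ≤ 6 / n := by
      rw [div_le_div_iff₀ hNpos (by linarith)]
      have : (0 : ℝ) ≤ i3 := by positivity
      nlinarith
    calc ((i3 : ℝ) / N) ^ 2 ≤ (6 / (n : ℝ)) ^ 2 := by gcongr
      _ = _ := by rw [div_pow]; norm_num
  have e4 : (2 * Q + 2) * k / N ≤ 4 / (n : ℝ) ^ 2 := by
    rw [div_le_div_iff₀ hNpos hnn]
    have h5 : (n : ℝ) ^ 5 ≤ Q := (pow_le_pow_right₀ hn1 (by norm_num)).trans hp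
    calc (2 * Q + 2) * k * (n : ℝ) ^ 2 ≤ (2 * Q + 2 * Q) * (n : ℝ) ^ 3 * (n : ℝ) ^ 2 := by
          gcongr; linarith
      _ = 4 * Q * (n : ℝ) ^ 5 := by ring
      _ ≤ 4 * Q * Q := by gcongr
      _ = 4 * (Q * Q) := by ring
      _ ≤ 4 * N := by gcongr
  have hQN : Q ≤ N := by nlinarith
  have e5 : 2 * (k : ℝ) ^ 2 / N ≤ 2 / (n : ℝ) ^ 2 := by
    rw [div_le_div_iff₀ hNpos hnn]
    have h5 : (n : ℝ) ^ 8 ≤ Q := (pow_le_pow_right₀ hn1 (by norm_num)).trans hp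
    calc 2 * (k : ℝ) ^ 2 * (n : ℝ) ^ 2 ≤ 2 * ((n : ℝ) ^ 3) ^ 2 * (n : ℝ) ^ 2 := by gcongr
      _ = 2 * (n : ℝ) ^ 8 := by ring
      _ ≤ 2 * N := by linarith
  have e6 : (k : ℝ) ^ 3 / N ≤ 1 / (n : ℝ) ^ 2 := by
    rw [div_le_div_iff₀ hNpos hnn]
    calc (k : ℝ) ^ 3 * (n : ℝ) ^ 2 ≤ ((n : ℝ) ^ 3) ^ 3 * (n : ℝ) ^ 2 := by gcongr
      _ = (n : ℝ) ^ 11 := by ring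
      _ ≤ 1 * N := by linarith
  gcongr
  calc _ ≤ 12 * (99 / (n : ℝ) ^ 2 + 1 / (n : ℝ) ^ 2 + 36 / (n : ℝ) ^ 2 + 4 / (n : ℝ) ^ 2 +
        2 / (n : ℝ) ^ 2 + 1 / (n : ℝ) ^ 2) := by gcongr
    _ = 1716 / (n : ℝ) ^ 2 := by ring
    _ ≤ _ := by gcongr; norm_num

theorem reg2 (n : ℕ) (hn : 36 ≤ n) (hf : 4 ^ (n + 1) ≤ (n / 15).factorial)
    (hp : (n : ℝ) ^ 11 ≤ 2 ^ (n + 1)) (k : ℕ) (hk3 : 3 ≤ k) (hkN : 2 * k ≤ n.factorial)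
    (hk : n ^ 3 ≤ k) :
    ∑ g : Perm (Fin n) × Perm (Fin n) with g ≠ 1, (fixk k (tw g) : ℝ) ≤
      n.factorial.choose k * (2000 / (n : ℝ) ^ 2) := by
  have hn' : (36 : ℝ) ≤ n := by exact_mod_cast hn
  have hcard : Fintype.card (Perm (Fin n)) = n.factorial := by
    rw [Fintype.card_perm, Fintype.card_fin]
  have hdl := dl_le n (by omega) hf hp
  have hhalf : dl n ≤ 1 / 2 := by
    refine hdl.trans ?_
    rw [div_le_div_iff₀ (by positivity) (by norm_num)]
    nlinarith
  have hterm : ∀ g : Perm (Fin n) × Perm (Fin n), g ≠ 1 → (fixk k (tw g) : ℝ) ≤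
      n.factorial.choose k * ((n.factorial + 1) * Real.exp (-(k / 6))) := by
    intro g hg
    have hfix : 2 * fixp 1 (tw g) ≤ n.factorial := by
      by_cases hx : ∃ x, tw g x = x
      · obtain ⟨x, hx⟩ := hx
        rw [tw_apply] at hx
        have hx2 : g.2 = x⁻¹ * g.1 * x := by
          have : g.1 * x = x * g.2 := by rw [mul_inv_eq_iff_eq_mul] at hx; exact hx
          rw [mul_assoc, this]; group
        have hg1 : g.1 ≠ 1 := by
          intro h1
          apply hg
          refine Prod.ext h1 ?_
          rw [hx2, h1]; simp
        have hge : g = (g.1, x⁻¹ * g.1 * x) := Prod.ext rfl hx2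
        rw [hge, fixp_conj, pow_one]
        have := cz_dl g.1 hg1
        have h2 : (cz g.1 : ℝ) ≤ 1 / 2 * n.factorial := this.trans (by gcongr)
        have h3 : (2 : ℝ) * (cz g.1 : ℝ) ≤ n.factorial := by linarith
        exact_mod_cast h3
      · push Not at hx
        have : fixp 1 (tw g) = 0 := by
          unfold fixp
          rw [card_eq_zero, filter_eq_empty_iff]
          intro x _
          rw [pow_one]; exact hx x
        rw [this]; simp
    have hsum : fixp 1 (tw g) + (tw g).support.card = n.factorial := by
      rw [← hcard, ← card_univ, fixp]
      rw [← card_filter_add_card_filter_not (s := (univ : Finset (Perm (Fin n))))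
        (fun x => ((tw g) ^ 1) x = x)]
      congr 2
    have := regime2 (tw g) k (by omega) (by rw [hcard]; exact hkN) (by rw [hcard]; omega)
    rw [hcard] at this
    exact this
  calc ∑ g : Perm (Fin n) × Perm (Fin n) with g ≠ 1, (fixk k (tw g) : ℝ)
      ≤ ∑ g : Perm (Fin n) × Perm (Fin n) with g ≠ 1,
        (n.factorial.choose k : ℝ) * ((n.factorial + 1) * Real.exp (-(k / 6))) :=
        sum_le_sum fun g hg => hterm g (mem_filter.1 hg).2
    _ ≤ ∑ g : Perm (Fin n) × Perm (Fin n),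
        (n.factorial.choose k : ℝ) * ((n.factorial + 1) * Real.exp (-(k / 6))) := by
        refine sum_le_sum_of_subset_of_nonneg (filter_subset _ _) fun h _ _ => by positivity
    _ = n.factorial.choose k * ((n.factorial : ℝ) ^ 2 *
          ((n.factorial + 1) * Real.exp (-(k / 6)))) := by
        rw [sum_const, card_univ, Fintype.card_prod, hcard, nsmul_eq_mul]
        push_cast; ring
    _ ≤ n.factorial.choose k * (1 / (n : ℝ) ^ 2) := by
        gcongr; exact ev_exp n hn k hk
    _ ≤ _ := by gcongr; norm_num

theorem reg (n : ℕ) (hn : 36 ≤ n) (hf : 4 ^ (n + 1) ≤ (n / 15).factorial)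
    (hp : (n : ℝ) ^ 11 ≤ 2 ^ (n + 1)) (k : ℕ) (hk3 : 3 ≤ k) (hkN : k + 3 ≤ n.factorial) :
    ∑ g : Perm (Fin n) × Perm (Fin n) with g ≠ 1, (fixk k (tw g) : ℝ) ≤
      n.factorial.choose k * (2000 / (n : ℝ) ^ 2) := by
  have hcard : Fintype.card (Perm (Fin n)) = n.factorial := by
    rw [Fintype.card_perm, Fintype.card_fin]
  have main : ∀ k : ℕ, 3 ≤ k → 2 * k ≤ n.factorial →
    ∑ g : Perm (Fin n) × Perm (Fin n) with g ≠ 1, (fixk k (tw g) : ℝ) ≤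
      n.factorial.choose k * (2000 / (n : ℝ) ^ 2) := by
    intro k hk3 hk
    rcases le_total k (n ^ 3) with h | h
    · exact reg1 n hn hf hp k hk3 (by omega) h
    · exact reg2 n hn hf hp k hk3 hk h
  by_cases h : 2 * k ≤ n.factorial
  · exact main k hk3 h
  · have := main (n.factorial - k) (by omega) (by omega)
    rw [Nat.choose_symm (by omega)] at this
    refine le_trans (le_of_eq ?_) this
    refine sum_congr rfl fun g _ => ?_
    rw [fixk_compl k (by rw [hcard]; omega), hcard]

/-- There exist `C > 0` and `N` such that for all `n ≥ N` and all `3 ≤ k ≤ n! - 3`,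
`|T(n,k)·n!²/binom(n!,k) − 1| ≤ C/n²`. -/
theorem orbit_count_asymptotic :
    ∃ C : ℝ, 0 < C ∧ ∃ N : ℕ, ∀ n : ℕ, N ≤ n → ∀ k : ℕ, 3 ≤ k → k + 3 ≤ n.factorial →
      |(T n k : ℝ) * (n.factorial : ℝ) ^ 2 / (n.factorial.choose k : ℝ) - 1| ≤
        C / (n : ℝ) ^ 2 := by
  obtain ⟨N, hN⟩ := Filter.eventually_atTop.1
    ((Filter.eventually_ge_atTop 36).and (ev_fact.and ev_pow))
  refine ⟨2000, by norm_num, N, fun n hn k hk3 hk => ?_⟩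
  obtain ⟨h36, hf, hp⟩ := hN n hn
  have hcard : Fintype.card (Perm (Fin n)) = n.factorial := by
    rw [Fintype.card_perm, Fintype.card_fin]
  have hr := reg n h36 hf hp k hk3 hk
  have hch : (0 : ℝ) < n.factorial.choose k := by
    exact_mod_cast Nat.choose_pos (by omega)
  have hb : (T n k : ℝ) * (n.factorial : ℝ) ^ 2 =
      ∑ g : Perm (Fin n) × Perm (Fin n), (fixk k (tw g) : ℝ) := by
    exact_mod_cast burnside n k
  have hid : fixk k (tw (1 : Perm (Fin n) × Perm (Fin n))) = n.factorial.choose k := by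
    rw [map_one, fixk, filter_true_of_mem, card_powersetCard, card_univ, hcard]
    intro s _
    simp
  have hs : ∑ g : Perm (Fin n) × Perm (Fin n), (fixk k (tw g) : ℝ) =
      n.factorial.choose k + ∑ g : Perm (Fin n) × Perm (Fin n) with g ≠ 1, (fixk k (tw g) : ℝ) := by
    rw [← add_sum_erase univ _ (mem_univ 1), hid, filter_ne']
  have h0 : 0 ≤ ∑ g : Perm (Fin n) × Perm (Fin n) with g ≠ 1, (fixk k (tw g) : ℝ) :=
    sum_nonneg fun g _ => Nat.cast_nonneg _
  rw [hb, hs]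
  generalize ∑ g : Perm (Fin n) × Perm (Fin n) with g ≠ 1, (fixk k (tw g) : ℝ) = S at hr h0 ⊢
  rw [add_div, div_self hch.ne', add_sub_cancel_left, abs_of_nonneg (div_nonneg h0 hch.le),
    div_le_iff₀ hch, mul_comm]
  exact hr
end

section
/- Let X be a finite set, let G be a finite group acting on X, let g ∈ G, and let k ∈ ℕ. Then the number of k-element subsets s ⊆ X with g·s = s (where g acts on subsets elementwise) equals Σ_{λ ⊢ k} ∏_{j=1}^{k} binom(|T_g(j)|/j, m_j(λ)), where the sum is over all integer partitions λ of k, m_j(λ) is the number of parts of λ equal to j, and binom(a,b) := 0 if a < b. -/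
open Finset MulAction

/-- `TgSet g j` is the set of points fixed by `g^j` but by no `g^i` with `1 ≤ i < j`. -/
def TgSet {G X : Type*} [Group G] [MulAction G X] (g : G) (j : ℕ) : Set X :=
  {x | g ^ j • x = x ∧ ∀ i : ℕ, 1 ≤ i → i < j → g ^ i • x ≠ x}

theorem aux_count {Q : Type*} [Fintype Q] [DecidableEq Q] (w : Q → ℕ) (m : Multiset ℕ)
    (J : Finset ℕ) (hJ : ∀ j ∈ m, j ∈ J) :
    #{S : Finset Q | S.val.map w = m} = ∏ j ∈ J, Nat.choose #{q : Q | w q = j} (m.count j) := by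
  classical
  have hcnt : ∀ (S : Finset Q) (j : ℕ), (S.val.map w).count j = #{q ∈ S | w q = j} := by
    intro S j
    rw [Multiset.count_map, Finset.card_def, Finset.filter_val]
    simp only [eq_comm]
  have : ∏ j ∈ J, Nat.choose #{q : Q | w q = j} (m.count j) =
      #(J.pi fun j => powersetCard (m.count j) {q : Q | w q = j}) := by
    simp [Finset.card_pi]
  rw [this]
  refine Finset.card_bij' (fun S _ j _ => {q ∈ S | w q = j})
    (fun t _ => Finset.univ.filter fun q : Q => ∃ h : w q ∈ J, q ∈ t (w q) h) ?_ ?_ ?_ ?_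
  · intro S hS
    simp only [mem_filter, mem_univ, true_and] at hS
    simp only [mem_pi, mem_powersetCard]
    intro j hj
    refine ⟨fun q hq => by simp_all, ?_⟩
    rw [← hcnt, hS]
  · intro t ht
    simp only [mem_pi, mem_powersetCard] at ht
    simp only [mem_filter, mem_univ, true_and]
    ext j
    rw [hcnt]
    by_cases hj : j ∈ J
    · rw [← (ht j hj).2]
      congr 1
      ext q
      simp only [mem_filter, mem_univ, true_and]
      constructor
      · rintro ⟨⟨h, hq⟩, rfl⟩
        exact hq
      · intro hq
        have := (ht j hj).1 hq
        simp only [mem_filter, mem_univ, true_and] at this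
        subst this
        exact ⟨⟨hj, hq⟩, rfl⟩
    · rw [Multiset.count_eq_zero_of_notMem (fun h => hj (hJ j h)), Finset.card_eq_zero]
      ext q
      simp only [mem_filter, mem_univ, true_and, notMem_empty, iff_false]
      rintro ⟨⟨h, hq⟩, rfl⟩
      exact hj h
  · intro S hS
    simp only [mem_filter, mem_univ, true_and] at hS
    ext q
    simp only [mem_filter, mem_univ, true_and]
    constructor
    · rintro ⟨h, hq, -⟩
      exact hq
    · intro hq
      refine ⟨hJ _ ?_, hq, trivial⟩
      rw [← hS]
      exact Multiset.mem_map_of_mem w hq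
  · intro t ht
    simp only [mem_pi, mem_powersetCard] at ht
    funext j hj
    ext q
    simp only [mem_filter, mem_univ, true_and]
    constructor
    · rintro ⟨⟨h, hq⟩, rfl⟩
      exact hq
    · intro hq
      have := (ht j hj).1 hq
      simp only [mem_filter, mem_univ, true_and] at this
      subst this
      exact ⟨⟨hj, hq⟩, rfl⟩

theorem aux_partition {Q : Type*} [Fintype Q] [DecidableEq Q] (w : Q → ℕ) (hw : ∀ q, 0 < w q)
    (k : ℕ) :
    #{S : Finset Q | ∑ q ∈ S, w q = k} =
      ∑ p : Nat.Partition k, ∏ j ∈ Finset.Icc 1 k,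
        Nat.choose #{q : Q | w q = j} (p.parts.count j) := by
  classical
  have h1 : ∀ p : Nat.Partition k, ∏ j ∈ Finset.Icc 1 k,
        Nat.choose #{q : Q | w q = j} (p.parts.count j) = #{S : Finset Q | S.val.map w = p.parts} := by
    intro p
    rw [aux_count]
    intro j hj
    rw [Finset.mem_Icc]
    refine ⟨p.parts_pos hj, ?_⟩
    have := Multiset.le_sum_of_mem hj
    rwa [p.parts_sum] at this
  simp_rw [h1]
  rw [← Finset.card_biUnion]
  · congr 1
    ext S
    simp only [mem_filter, mem_univ, true_and, mem_biUnion]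
    constructor
    · intro h
      refine ⟨⟨S.val.map w, ?_, h⟩, rfl⟩
      intro i hi
      obtain ⟨q, -, rfl⟩ := Multiset.mem_map.1 hi
      exact hw q
    · rintro ⟨p, hp⟩
      rw [← p.parts_sum, ← hp]
      rfl
  · intro p _ p' _ hne
    rw [Function.onFun, Finset.disjoint_left]
    intro S hS hS'
    simp only [mem_filter, mem_univ, true_and] at hS hS'
    exact hne (Nat.Partition.ext (hS.symm.trans hS'))

theorem aux_mem {G X : Type*} [Group G] [Finite X] [MulAction G X] (g : G) (j : ℕ)
    (hj : 1 ≤ j) (x : X) :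
    x ∈ (TgSet g j : Set X) ↔ Function.minimalPeriod (g • · : X → X) x = j := by
  have hit : ∀ n : ℕ, Function.IsPeriodicPt (g • · : X → X) n x ↔ g ^ n • x = x := by
    intro n
    rw [Function.IsPeriodicPt, Function.IsFixedPt, smul_iterate]
  constructor
  · rintro ⟨h1, h2⟩
    have hp := (hit j).2 h1
    refine le_antisymm (hp.minimalPeriod_le hj) ?_
    by_contra hlt
    push Not at hlt
    exact h2 _ (hp.minimalPeriod_pos hj) hlt
      ((hit _).1 (Function.isPeriodicPt_minimalPeriod _ _))
  · rintro rfl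
    refine ⟨(hit _).1 (Function.isPeriodicPt_minimalPeriod _ _), fun i hi hlt h => ?_⟩
    exact absurd (((hit i).2 h).minimalPeriod_le hi) (by omega)

/-- The number of `k`-subsets of `X` fixed by `g` equals
`Σ_{λ ⊢ k} ∏_{j=1}^k binom(|T_g(j)|/j, m_j(λ))`. -/
theorem card_fixed_k_subsets {G X : Type*} [Group G] [Finite G] [Fintype X] [DecidableEq X]
    [MulAction G X] (g : G) (k : ℕ) :
    Nat.card {s : Finset X // s.card = k ∧ s.image (fun x => g • x) = s} =
      ∑ p : Nat.Partition k, ∏ j ∈ Finset.Icc 1 k,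
        Nat.choose (Nat.card (TgSet g j : Set X) / j) (Multiset.count j p.parts) := by
  classical
  let Q := orbitRel.Quotient (Subgroup.zpowers g) X
  let mk : X → Q := fun x => Quotient.mk'' x
  have hmk : ∀ x y, mk x = mk y ↔ x ∈ orbit (Subgroup.zpowers g) y := fun x y => by
    rw [← orbitRel_apply]; exact Quotient.eq''
  have hsurj : ∀ q : Q, ∃ x, mk x = q := fun q => Quotient.exists_rep q
  letI : Fintype Q := Fintype.ofSurjective mk hsurj
  let w : Q → ℕ := fun q => #{x : X | mk x = q}
  have hw : ∀ q, 0 < w q := fun q => by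
    obtain ⟨x, hx⟩ := hsurj q
    exact Finset.card_pos.2 ⟨x, by simpa using hx⟩
  have hper : ∀ x, w (mk x) = Function.minimalPeriod (g • · : X → X) x := by
    intro x
    rw [minimalPeriod_eq_card, ← Set.toFinset_card]
    show #{y : X | mk y = mk x} = _
    congr 1
    ext y
    simp [hmk]
  have hT : ∀ j, 1 ≤ j → Nat.card (TgSet g j : Set X) / j = #{q : Q | w q = j} := by
    intro j hj
    have : Nat.card (TgSet g j : Set X) = #{q : Q | w q = j} * j := by
      have h0 : Nat.card (TgSet g j : Set X) = #{x : X | w (mk x) = j} := by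
        rw [Nat.card_eq_fintype_card, ← Set.toFinset_card]
        congr 1
        ext x
        rw [Set.mem_toFinset, aux_mem g j hj, ← hper]
        simp
      rw [h0, Finset.card_eq_sum_card_fiberwise (f := mk) (t := {q : Q | w q = j})
        (fun x hx => by simpa using hx)]
      rw [Finset.sum_const_nat]
      intro q hq
      simp only [mem_filter, mem_univ, true_and] at hq
      rw [← hq, Finset.filter_filter]
      show _ = #{x : X | mk x = q}
      congr 1
      ext x
      simp only [mem_filter, mem_univ, true_and, and_iff_right_iff_imp]
      rintro rfl
      rfl
    rw [this, Nat.mul_div_cancel _ hj]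
  have hR : ∀ p : Nat.Partition k, ∏ j ∈ Finset.Icc 1 k,
        Nat.choose (Nat.card (TgSet g j : Set X) / j) (Multiset.count j p.parts) =
      ∏ j ∈ Finset.Icc 1 k, Nat.choose #{q : Q | w q = j} (p.parts.count j) := fun p =>
    Finset.prod_congr rfl fun j hj => by rw [hT j (Finset.mem_Icc.1 hj).1]
  simp_rw [hR]
  rw [← aux_partition w hw k, Nat.card_eq_fintype_card, Fintype.card_subtype]
  have hcard : ∀ S : Finset Q, #{x : X | mk x ∈ S} = ∑ q ∈ S, w q := by
    intro S
    rw [Finset.card_eq_sum_card_fiberwise (f := mk) (t := S) (fun x hx => by simpa using hx)]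
    refine Finset.sum_congr rfl fun q hq => ?_
    rw [Finset.filter_filter]
    show _ = #{x : X | mk x = q}
    congr 1
    ext x
    simp only [mem_filter, mem_univ, true_and, and_iff_right_iff_imp]
    rintro rfl
    exact hq
  have hgmk : ∀ x, mk (g • x) = mk x := fun x => by
    rw [hmk]
    exact ⟨⟨g, Subgroup.mem_zpowers g⟩, rfl⟩
  have hinv : ∀ s : Finset X, s.image (fun x => g • x) = s →
      ({x : X | mk x ∈ s.image mk} : Finset X) = s := by
    intro s hs
    have hpow : ∀ n : ℕ, ∀ y ∈ s, g ^ n • y ∈ s := by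
      intro n
      induction n with
      | zero => simp
      | succ n ih =>
        intro y hy
        rw [pow_succ', mul_smul]
        have := Finset.mem_image_of_mem (fun x => g • x) (ih y hy)
        rwa [hs] at this
    ext x
    simp only [mem_filter, mem_univ, true_and, mem_image]
    constructor
    · rintro ⟨y, hy, hxy⟩
      obtain ⟨⟨h, hh⟩, rfl⟩ := (hmk x y).1 hxy.symm
      obtain ⟨n, rfl⟩ := (mem_powers_iff_mem_zpowers).2 hh
      exact hpow n y hy
    · intro hx
      exact ⟨x, hx, rfl⟩
  have hinv2 : ∀ S : Finset Q, ({x : X | mk x ∈ S} : Finset X).image mk = S := by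
    intro S
    ext q
    simp only [mem_filter, mem_univ, true_and, mem_image]
    constructor
    · rintro ⟨x, hx, rfl⟩
      exact hx
    · intro hq
      obtain ⟨x, rfl⟩ := hsurj q
      exact ⟨x, hq, rfl⟩
  refine Finset.card_bij' (fun s _ => s.image mk) (fun S _ => Finset.univ.filter fun x : X => mk x ∈ S) ?_ ?_ ?_ ?_
  · intro s hs
    simp only [mem_filter, mem_univ, true_and] at hs ⊢
    rw [← hcard, hinv s hs.2, hs.1]
  · intro S hS
    simp only [mem_filter, mem_univ, true_and] at hS ⊢
    refine ⟨by rw [hcard, hS], ?_⟩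
    ext x
    simp only [mem_filter, mem_univ, true_and, mem_image]
    constructor
    · rintro ⟨y, hy, rfl⟩
      rwa [hgmk]
    · intro hx
      refine ⟨g⁻¹ • x, ?_, smul_inv_smul g x⟩
      rwa [← hgmk, smul_inv_smul]
  · intro s hs
    simp only [mem_filter, mem_univ, true_and] at hs
    exact hinv s hs.2
  · intro S _
    exact hinv2 S
end

section
/- Let X be a finite set, let G be a finite group acting on X, let g ∈ G, let k ∈ ℕ, and let λ be an integer partition of k with m_j(λ) parts equal to j. Then the number of k-element subsets s ⊆ X such that g·s = s and such that, for every j, the number of g-orbits of cardinality j contained in s equals m_j(λ), is exactly ∏_{j=1}^{k} binom(|T_g(j)|/j, m_j(λ)), with binom(a,b) := 0 if a < b. -/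
open Finset MulAction

lemma profile_count {Ω : Type*} [Fintype Ω] [DecidableEq Ω] (c : Ω → ℕ) (m : ℕ → ℕ)
    (J : Finset ℕ) (hm : ∀ j ∉ J, m j = 0) :
    Nat.card {A : Finset Ω // ∀ j, #(A.filter (fun o => c o = j)) = m j} =
      ∏ j ∈ J, (#(univ.filter (fun o : Ω => c o = j))).choose (m j) := by
  let e : {A : Finset Ω // ∀ j, #(A.filter (fun o => c o = j)) = m j} ≃
      ((j : J) → {B // B ∈ powersetCard (m j) (univ.filter (fun o : Ω => c o = j))}) :=
    { toFun := fun A j => ⟨A.1.filter (fun o => c o = j), by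
        rw [mem_powersetCard]
        exact ⟨filter_subset_filter _ (subset_univ _), A.2 j⟩⟩
      invFun := fun f => ⟨univ.filter (fun o => ∃ h : c o ∈ J, o ∈ (f ⟨c o, h⟩).1), by
        intro j
        by_cases hj : j ∈ J
        · have h := mem_powersetCard.1 (f ⟨j, hj⟩).2
          rw [← h.2]
          congr 1
          ext o
          simp only [mem_filter, mem_univ, true_and]
          constructor
          · rintro ⟨⟨h1, h2⟩, rfl⟩
            exact h2
          · intro ho
            have := h.1 ho
            simp only [mem_filter, mem_univ, true_and] at this
            subst this
            exact ⟨⟨hj, ho⟩, rfl⟩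
        · rw [hm j hj, card_eq_zero, filter_eq_empty_iff]
          rintro o ho rfl
          simp only [mem_filter, mem_univ, true_and] at ho
          exact hj ho.1⟩
      left_inv := by
        rintro ⟨A, hA⟩
        apply Subtype.ext
        ext o
        simp only [mem_filter, mem_univ, true_and, and_true]
        constructor
        · rintro ⟨_, h⟩
          exact h
        · intro ho
          refine ⟨?_, ho⟩
          by_contra hj
          have := hA (c o)
          rw [hm _ hj, card_eq_zero, filter_eq_empty_iff] at this
          exact this ho rfl
      right_inv := by
        intro f
        funext ⟨j, hj⟩
        apply Subtype.ext
        ext o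
        have h := mem_powersetCard.1 (f ⟨j, hj⟩).2
        simp only [mem_filter, mem_univ, true_and]
        constructor
        · rintro ⟨⟨h1, h2⟩, rfl⟩
          exact h2
        · intro ho
          have := h.1 ho
          simp only [mem_filter, mem_univ, true_and] at this
          subst this
          exact ⟨⟨hj, ho⟩, rfl⟩ }
  rw [Nat.card_congr e, Nat.card_pi,
    ← prod_coe_sort J (fun j => (#(univ.filter (fun o : Ω => c o = j))).choose (m j))]
  refine prod_congr rfl fun j _ => ?_
  rw [Nat.card_eq_fintype_card, Fintype.card_coe, card_powersetCard]

lemma parts_sum {k : ℕ} (p : Nat.Partition k) :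
    ∑ j ∈ Icc 1 k, j * Multiset.count j p.parts = k := by
  conv_rhs => rw [← p.parts_sum, sum_multiset_count]
  symm
  simp only [smul_eq_mul, mul_comm]
  apply sum_subset
  · intro j hj
    rw [Multiset.mem_toFinset] at hj
    exact mem_Icc.2 ⟨p.parts_pos hj, p.le_of_mem_parts hj⟩
  · intro j _ hj
    rw [Multiset.mem_toFinset] at hj
    simp [Multiset.count_eq_zero_of_notMem hj]

lemma count_zero {k : ℕ} (p : Nat.Partition k) (j : ℕ) (hj : j ∉ Icc 1 k) :
    Multiset.count j p.parts = 0 := by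
  apply Multiset.count_eq_zero_of_notMem
  intro h
  exact hj (mem_Icc.2 ⟨p.parts_pos h, p.le_of_mem_parts h⟩)

lemma mem_TgSet_iff {G X : Type*} [Group G] [Finite X] [MulAction G X] (g : G) (j : ℕ)
    (hj : 1 ≤ j) (x : X) :
    x ∈ (TgSet g j : Set X) ↔ (orbit (Subgroup.zpowers g) x).ncard = j := by
  classical
  have : Fintype (orbit (Subgroup.zpowers g) x) := Fintype.ofFinite _
  have h1 : (orbit (Subgroup.zpowers g) x).ncard = Function.minimalPeriod (g • ·) x := by
    rw [minimalPeriod_eq_card, ← Nat.card_eq_fintype_card]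
    rfl
  have hpos : 0 < Function.minimalPeriod (g • ·) x :=
    Nat.pos_of_ne_zero (minimalPeriod_pos g x).out
  have hper : ∀ n : ℕ, Function.IsPeriodicPt (g • ·) n x ↔ g ^ n • x = x := by
    intro n
    rw [Function.IsPeriodicPt, smul_iterate, Function.IsFixedPt]
  rw [h1]
  constructor
  · rintro ⟨h2, h3⟩
    have hle := Function.IsPeriodicPt.minimalPeriod_le hj ((hper j).2 h2)
    by_contra hne
    exact h3 _ hpos (lt_of_le_of_ne hle hne)
      ((hper _).1 (Function.isPeriodicPt_minimalPeriod _ _))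
  · rintro rfl
    refine ⟨(hper _).1 (Function.isPeriodicPt_minimalPeriod _ _), ?_⟩
    intro i hi hlt h
    exact absurd (Function.IsPeriodicPt.minimalPeriod_le hi ((hper i).2 h)) (not_le.2 hlt)

lemma image_eq_iff {G X : Type*} [Group G] [Fintype X] [DecidableEq X] [MulAction G X] (g : G)
    (s : Finset X) :
    s.image (fun x => g • x) = s ↔
      ∀ x y, y ∈ orbit (Subgroup.zpowers g) x → (y ∈ s ↔ x ∈ s) := by
  constructor
  · intro h
    have h1 : ∀ x, g • x ∈ s ↔ x ∈ s := by
      intro x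
      conv_lhs => rw [← h]
      simp
    have h2 : ∀ a ∈ Subgroup.zpowers g, ∀ x, a • x ∈ s ↔ x ∈ s := by
      intro a ha
      rw [Subgroup.zpowers_eq_closure] at ha
      induction ha using Subgroup.closure_induction with
      | mem a ha =>
        rw [Set.mem_singleton_iff] at ha
        subst ha
        exact h1
      | one => simp
      | mul a b _ _ iha ihb =>
        intro x
        rw [mul_smul, iha, ihb]
      | inv a _ iha =>
        intro x
        rw [← iha, smul_inv_smul]
    rintro x _ ⟨⟨a, ha⟩, rfl⟩
    exact h2 a ha x
  · intro h
    have h1 : ∀ x, g • x ∈ s ↔ x ∈ s := fun x =>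
      h x (g • x) ⟨⟨g, Subgroup.mem_zpowers g⟩, rfl⟩
    apply eq_of_subset_of_card_le
    · intro y hy
      obtain ⟨x, hx, rfl⟩ := mem_image.1 hy
      exact (h1 x).2 hx
    · rw [card_image_of_injective _ (MulAction.injective g)]

/-- The number of `k`-subsets `s` of `X` fixed by `g` in which, for every `j`, the number of
`g`-orbits of cardinality `j` contained in `s` is exactly `m_j(λ)`, equals
`∏_{j=1}^k binom(|T_g(j)|/j, m_j(λ))`. -/
theorem card_fixed_k_subsets_with_profile {G X : Type*} [Group G] [Finite G] [Fintype X]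
    [DecidableEq X] [MulAction G X] (g : G) (k : ℕ) (p : Nat.Partition k) :
    Nat.card {s : Finset X // s.card = k ∧ s.image (fun x => g • x) = s ∧
        ∀ j : ℕ, Nat.card {O : Set X //
            (∃ x : X, O = MulAction.orbit (Subgroup.zpowers g) x) ∧
              O.ncard = j ∧ O ⊆ ↑s} = Multiset.count j p.parts} =
      ∏ j ∈ Finset.Icc 1 k,
        Nat.choose (Nat.card (TgSet g j : Set X) / j) (Multiset.count j p.parts) := by
  classical
  let Ω := {O : Set X // ∃ x : X, O = MulAction.orbit (Subgroup.zpowers g) x}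
  have : Fintype Ω := Fintype.ofFinite _
  let q : X → Ω := fun x => ⟨orbit (Subgroup.zpowers g) x, x, rfl⟩
  let c : Ω → ℕ := fun o => o.1.ncard
  have hq : ∀ (x : X) (o : Ω), x ∈ o.1 ↔ q x = o := by
    rintro x ⟨_, y, rfl⟩
    rw [Subtype.ext_iff]
    exact orbit_eq_iff.symm
  have hqs : ∀ o : Ω, ∃ x, q x = o := by
    rintro ⟨_, y, rfl⟩
    exact ⟨y, rfl⟩
  have hc : ∀ o : Ω, #(univ.filter (fun x => q x = o)) = c o := by
    intro o
    change _ = o.1.ncard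
    rw [← Set.ncard_coe_finset]
    congr 1
    ext x
    simp [hq]
  have hT : ∀ j ∈ Icc 1 k, Nat.card (TgSet g j : Set X) / j =
      #(univ.filter (fun o : Ω => c o = j)) := by
    intro j hj
    have hj1 := (mem_Icc.1 hj).1
    have h1 : Nat.card (TgSet g j : Set X) = #(univ.filter (fun x : X => c (q x) = j)) := by
      change Set.ncard _ = _
      rw [← Set.ncard_coe_finset]
      congr 1
      ext x
      rw [mem_TgSet_iff g j hj1 x]
      simp [c, q]
    have h2 : #(univ.filter (fun x : X => c (q x) = j)) =
        #(univ.filter (fun o : Ω => c o = j)) * j := by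
      rw [card_eq_sum_card_fiberwise (f := q) (t := univ.filter (fun o : Ω => c o = j))]
      · rw [sum_const_nat]
        intro o ho
        have ho' := (mem_filter.1 ho).2
        rw [← ho', ← hc o]
        congr 1
        ext x
        simp only [mem_filter, mem_univ, true_and]
        constructor
        · exact fun h => h.2
        · rintro rfl
          exact ⟨(hc _).symm, rfl⟩
      · intro x hx
        simpa using hx
    rw [h1, h2, Nat.mul_div_cancel _ hj1]
  rw [prod_congr rfl (fun j hj => by rw [hT j hj]),
    ← profile_count c (fun j => Multiset.count j p.parts) (Icc 1 k) (count_zero p)]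
  have key : ∀ (A : Finset Ω) (s : Finset X), (∀ x, x ∈ s ↔ q x ∈ A) → ∀ j : ℕ,
      Nat.card {O : Set X // (∃ x : X, O = MulAction.orbit (Subgroup.zpowers g) x) ∧
              O.ncard = j ∧ O ⊆ ↑s} = #(A.filter (fun o => c o = j)) := by
    intro A s hs j
    have hsub : ∀ o : Ω, o.1 ⊆ (↑s : Set X) ↔ o ∈ A := by
      intro o
      obtain ⟨x, hx⟩ := hqs o
      constructor
      · intro h
        have := (hs x).1 (h ((hq x o).2 hx))
        rwa [hx] at this
      · intro ho y hy
        have h1 := (hq y o).1 hy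
        exact (hs y).2 (h1 ▸ ho)
    rw [← Fintype.card_coe, ← Nat.card_eq_fintype_card]
    refine Nat.card_congr
      { toFun := fun O => ⟨⟨O.1, O.2.1⟩, mem_filter.2 ⟨(hsub _).1 O.2.2.2, O.2.2.1⟩⟩
        invFun := fun o => ⟨o.1.1, o.1.2, (mem_filter.1 o.2).2,
          (hsub _).2 (mem_filter.1 o.2).1⟩
        left_inv := fun _ => rfl
        right_inv := fun _ => rfl }
  have hcard : ∀ (A : Finset Ω) (s : Finset X), (∀ x, x ∈ s ↔ q x ∈ A) →
      (∀ j, #(A.filter (fun o => c o = j)) = Multiset.count j p.parts) → #s = k := by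
    intro A s hs hA
    have h1 : #s = ∑ o ∈ A, c o := by
      rw [card_eq_sum_card_fiberwise (f := q) (t := A) (fun x hx => (hs x).1 hx)]
      refine sum_congr rfl fun o ho => ?_
      rw [← hc o]
      congr 1
      ext x
      simp only [mem_filter, mem_univ, true_and]
      constructor
      · exact fun h => h.2
      · rintro rfl
        exact ⟨(hs x).2 ho, rfl⟩
    have hmaps : ∀ o ∈ A, c o ∈ Icc 1 k := by
      intro o ho
      by_contra hj
      have h2 := hA (c o)
      rw [count_zero p _ hj, card_eq_zero, filter_eq_empty_iff] at h2
      exact h2 ho rfl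
    rw [h1, ← sum_fiberwise_of_maps_to hmaps]
    conv_rhs => rw [← parts_sum p]
    refine sum_congr rfl fun j _ => ?_
    rw [← hA j, mul_comm]
    exact sum_const_nat fun o ho => (mem_filter.1 ho).2
  have hinv : ∀ s : Finset X, s.image (fun x => g • x) = s →
      ∀ x, x ∈ s ↔ q x ∈ s.image q := by
    intro s h x
    constructor
    · exact fun hx => mem_image_of_mem q hx
    · intro hx
      obtain ⟨y, hy, hyx⟩ := mem_image.1 hx
      exact ((image_eq_iff g s).1 h x y ((hq y (q x)).2 hyx)).1 hy
  refine Nat.card_congr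
    { toFun := fun s => ⟨s.1.image q, fun j => by
        rw [← key _ s.1 (hinv s.1 s.2.2.1) j]
        exact s.2.2.2 j⟩
      invFun := fun A => ⟨univ.filter (fun x => q x ∈ A.1),
        hcard A.1 _ (fun x => by simp) A.2, by
          rw [image_eq_iff]
          intro x y hy
          have : q y = q x := (hq y (q x)).1 hy
          simp [this], fun j => by
          rw [key A.1 _ (fun x => by simp) j]
          exact A.2 j⟩
      left_inv := ?_
      right_inv := ?_ }
  · rintro ⟨s, h1, h2, h3⟩
    apply Subtype.ext
    ext x
    rw [hinv s h2 x]
    simp only [mem_filter, mem_univ, true_and]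
  · rintro ⟨A, hA⟩
    apply Subtype.ext
    ext o
    obtain ⟨x, rfl⟩ := hqs o
    simp only [mem_image, mem_filter, mem_univ, true_and]
    constructor
    · rintro ⟨y, hy, hyx⟩
      exact hyx ▸ hy
    · exact fun h => ⟨x, h, rfl⟩
end

section
/- Let σ ∈ Sₙ and let c_j(σ) denote the number of cycles of length j of σ. Then for every 0 ≤ k ≤ n, the number of k-element subsets A ⊆ {1,…,n} with σ(A) = A equals Σ_{λ ⊢ k} ∏_{j=1}^{k} binom(c_j(σ), m_j(λ)), where the sum is over all integer partitions λ of k, m_j(λ) is the number of parts of λ equal to j, and binom(a,b) := 0 if a < b. -/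
open Equiv Finset

/-- `cycleCount σ j` is the number of `j`-cycles of `σ`, with fixed points counted as
`1`-cycles. -/
noncomputable def cycleCount {n : ℕ} (σ : Perm (Fin n)) (j : ℕ) : ℕ :=
  if j = 1 then Nat.card {x : Fin n // σ x = x} else Multiset.count j σ.cycleType

namespace CFK

open Classical in
theorem prodLemma {Q : Type*} [Fintype Q] (w : Q → ℕ) (m : Multiset ℕ) (J : Finset ℕ)
    (hm : ∀ j ∈ m, j ∈ J) :
    #{B : Finset Q | B.val.map w = m} =
      ∏ j ∈ J, Nat.choose #{q : Q | w q = j} (Multiset.count j m) := by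
  have h1 : ∏ j ∈ J, Nat.choose #{q : Q | w q = j} (Multiset.count j m) =
      #(J.pi (fun j => powersetCard (Multiset.count j m) ({q : Q | w q = j} : Finset Q))) := by
    simp [Finset.card_pi, card_powersetCard]
  have hcount : ∀ (B : Finset Q) j, Multiset.count j (B.val.map w) = #{q ∈ B | w q = j} := by
    intro B j
    rw [Multiset.count_map]
    simp only [Finset.card, Finset.filter_val, eq_comm]
  rw [h1]
  refine Finset.card_bij (fun B _ => fun j _ => {q ∈ B | w q = j}) ?_ ?_ ?_
  · intro B hB
    simp only [mem_filter, mem_univ, true_and] at hB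
    simp only [mem_pi, mem_powersetCard]
    intro j hj
    refine ⟨fun q hq => by simp at hq ⊢; exact hq.2, ?_⟩
    rw [← hcount, hB]
  · intro B hB B' hB' h
    simp only [mem_filter, mem_univ, true_and] at hB hB'
    ext q
    by_cases hq : w q ∈ J
    · have := congrFun (congrFun h (w q)) hq
      have := Finset.ext_iff.1 this q
      simpa using this
    · have h1 : q ∉ B := fun hb => hq (hm _ (hB ▸ Multiset.mem_map_of_mem w hb))
      have h2 : q ∉ B' := fun hb => hq (hm _ (hB' ▸ Multiset.mem_map_of_mem w hb))
      simp [h1, h2]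
  · intro f hf
    simp only [mem_pi, mem_powersetCard] at hf
    have key : ∀ j (hj : j ∈ J),
        ({q ∈ ({q : Q | ∃ h : w q ∈ J, q ∈ f (w q) h} : Finset Q) | w q = j}) = f j hj := by
      intro j hj
      ext q
      simp only [mem_filter, mem_univ, true_and]
      constructor
      · rintro ⟨⟨h, hq⟩, rfl⟩
        exact hq
      · intro hq
        have : w q = j := by simpa using (hf j hj).1 hq
        subst this
        exact ⟨⟨hj, hq⟩, rfl⟩
    refine ⟨({q : Q | ∃ h : w q ∈ J, q ∈ f (w q) h} : Finset Q), ?_, ?_⟩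
    · simp only [mem_filter, mem_univ, true_and]
      ext j
      rw [hcount]
      by_cases hj : j ∈ J
      · rw [key j hj, (hf j hj).2]
      · rw [Multiset.count_eq_zero_of_notMem (fun h => hj (hm _ h)), Finset.card_eq_zero]
        ext q
        simp only [mem_filter, mem_univ, true_and, notMem_empty, iff_false]
        rintro ⟨⟨h, -⟩, rfl⟩
        exact hj h
    · funext j hj
      exact key j hj

open Classical in
theorem sumLemma {Q : Type*} [Fintype Q] (w : Q → ℕ) (hw : ∀ q, 0 < w q) (k : ℕ) :
    #{B : Finset Q | ∑ q ∈ B, w q = k} =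
      ∑ p : Nat.Partition k, ∏ j ∈ Finset.Icc 1 k,
        Nat.choose #{q : Q | w q = j} (Multiset.count j p.parts) := by
  have h : ∀ p : Nat.Partition k, ∏ j ∈ Finset.Icc 1 k,
        Nat.choose #{q : Q | w q = j} (Multiset.count j p.parts) =
        #{B : Finset Q | B.val.map w = p.parts} := fun p =>
    (prodLemma w p.parts _ (fun j hj => Finset.mem_Icc.2
      ⟨p.parts_pos hj, Nat.Partition.le_of_mem_parts hj⟩)).symm
  simp only [h]
  rw [← Finset.card_biUnion]
  · congr 1
    ext B
    simp only [mem_filter, mem_univ, true_and, mem_biUnion]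
    constructor
    · intro hB
      refine ⟨⟨B.val.map w, ?_, hB⟩, rfl⟩
      intro i hi
      obtain ⟨q, -, rfl⟩ := Multiset.mem_map.1 hi
      exact hw q
    · rintro ⟨p, hp⟩
      have := p.parts_sum
      rw [← hp] at this
      exact this
  · intro p _ p' _ hne
    rw [Function.onFun, Finset.disjoint_left]
    intro B hB hB'
    simp only [mem_filter, mem_univ, true_and] at hB hB'
    exact hne (Nat.Partition.ext (hB.symm.trans hB'))

abbrev Q {n : ℕ} (σ : Perm (Fin n)) := Quotient (Perm.SameCycle.setoid σ)

def mk {n : ℕ} (σ : Perm (Fin n)) (x : Fin n) : Q σ := Quotient.mk _ x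

theorem mk_eq {n : ℕ} (σ : Perm (Fin n)) (x y : Fin n) : mk σ x = mk σ y ↔ σ.SameCycle x y :=
  Quotient.eq

theorem mk_surj {n : ℕ} (σ : Perm (Fin n)) (q : Q σ) : ∃ x, mk σ x = q :=
  Quotient.exists_rep q

theorem mk_apply {n : ℕ} (σ : Perm (Fin n)) (x : Fin n) : mk σ (σ x) = mk σ x := by
  rw [mk_eq]
  exact (Perm.sameCycle_apply_left).2 (Perm.SameCycle.refl _ _)

open Classical in
noncomputable def wt {n : ℕ} (σ : Perm (Fin n)) (q : Q σ) : ℕ := #{x : Fin n | mk σ x = q}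

theorem wt_pos {n : ℕ} (σ : Perm (Fin n)) (q : Q σ) : 0 < wt σ q := by
  obtain ⟨x, hx⟩ := mk_surj σ q
  exact Finset.card_pos.2 ⟨x, by simp [hx]⟩

theorem wt_one {n : ℕ} (σ : Perm (Fin n)) (x : Fin n) : wt σ (mk σ x) = 1 ↔ σ x = x := by
  classical
  unfold wt
  constructor
  · intro h
    rw [Finset.card_eq_one] at h
    obtain ⟨a, ha⟩ := h
    have h1 : x ∈ ({a} : Finset (Fin n)) := by rw [← ha]; simp
    have h2 : σ x ∈ ({a} : Finset (Fin n)) := by rw [← ha]; simp [mk_apply]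
    simp only [mem_singleton] at h1 h2
    rw [h2, h1]
  · intro h
    rw [Finset.card_eq_one]
    refine ⟨x, ?_⟩
    ext y
    simp only [mem_filter, mem_univ, true_and, mem_singleton, mk_eq]
    constructor
    · intro hy
      exact (hy.symm.eq_of_left h).symm
    · rintro rfl
      exact Perm.SameCycle.refl _ _

theorem wt_support {n : ℕ} (σ : Perm (Fin n)) (x : Fin n) (hx : σ x ≠ x) :
    #(σ.cycleOf x).support = wt σ (mk σ x) := by
  classical
  unfold wt
  congr 1
  ext y
  simp only [mem_filter, mem_univ, true_and, mk_eq]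
  rw [Perm.mem_support_cycleOf_iff' hx]
  exact Perm.sameCycle_comm

open Classical in
theorem count_eq {n : ℕ} (σ : Perm (Fin n)) (j : ℕ) :
    #{q : Q σ | wt σ q = j} = cycleCount σ j := by
  unfold cycleCount
  split_ifs with hj
  · subst hj
    rw [Nat.card_eq_fintype_card, Fintype.card_subtype]
    symm
    refine Finset.card_bij (fun x _ => mk σ x) ?_ ?_ ?_
    · intro x hx
      simpa [wt_one] using hx
    · intro x hx y hy h
      simp only [mem_filter, mem_univ, true_and] at hx
      exact ((mk_eq σ x y).1 h).eq_of_left hx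
    · intro q hq
      obtain ⟨x, rfl⟩ := mk_surj σ q
      exact ⟨x, by simpa [wt_one] using hq, rfl⟩
  · have h1 : Multiset.count j σ.cycleType = #{c ∈ σ.cycleFactorsFinset | #c.support = j} := by
      rw [Perm.cycleType_def, Multiset.count_map]
      simp only [Finset.card, Finset.filter_val, Function.comp, eq_comm]
      congr!
    rw [h1]
    have hout : ∀ q : Q σ, mk σ q.out = q := fun q => Quotient.out_eq q
    have hne : ∀ q : Q σ, wt σ q = j → σ q.out ≠ q.out := by
      intro q hq h
      rw [← wt_one, hout, hq] at h
      exact hj h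
    refine Finset.card_bij (fun q _ => σ.cycleOf q.out) ?_ ?_ ?_
    · intro q hq
      simp only [mem_filter, mem_univ, true_and] at hq
      have := hne q hq
      simp only [mem_filter, Perm.cycleOf_mem_cycleFactorsFinset_iff, Perm.mem_support]
      refine ⟨this, ?_⟩
      rw [wt_support σ _ this, hout, hq]
    · intro q hq q' hq' h
      simp only [mem_filter, mem_univ, true_and] at hq hq'
      rw [← hout q, ← hout q', mk_eq]
      exact (Perm.sameCycle_iff_cycleOf_eq_of_mem_support (Perm.mem_support.2 (hne q hq))
        (Perm.mem_support.2 (hne q' hq'))).2 h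
    · intro c hc
      simp only [mem_filter] at hc
      obtain ⟨hc, hcj⟩ := hc
      obtain ⟨x, hx⟩ := (Perm.mem_cycleFactorsFinset_iff.1 hc).1.nonempty_support
      have hcx := Perm.cycle_is_cycleOf hx hc
      have hxs : σ x ≠ x := Perm.mem_support.1 (Perm.mem_cycleFactorsFinset_support_le hc hx)
      refine ⟨mk σ x, ?_, ?_⟩
      · simp only [mem_filter, mem_univ, true_and]
        rw [← wt_support σ x hxs, ← hcx, hcj]
      · have := (mk_eq σ _ _).1 (hout (mk σ x))
        rw [hcx]
        exact this.cycleOf_eq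

end CFK

/-- The number of `k`-subsets `A ⊆ {1,…,n}` with `σ(A) = A` equals
`Σ_{λ ⊢ k} ∏_{j=1}^k binom(c_j(σ), m_j(λ))`. -/
theorem card_fixed_k_subsets_perm {n : ℕ} (σ : Perm (Fin n)) (k : ℕ) (hk : k ≤ n) :
    Nat.card {A : Finset (Fin n) // A.card = k ∧ A.image (fun x => σ x) = A} =
      ∑ p : Nat.Partition k, ∏ j ∈ Finset.Icc 1 k,
        Nat.choose (cycleCount σ j) (Multiset.count j p.parts) := by
  classical
  have h := CFK.sumLemma (CFK.wt σ) (CFK.wt_pos σ) k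
  simp only [CFK.count_eq] at h
  rw [← h, Nat.card_eq_fintype_card, Fintype.card_subtype]
  symm
  have inv : ∀ A : Finset (Fin n), A.image (fun x => σ x) = A → ∀ x, σ x ∈ A ↔ x ∈ A := by
    intro A hA x
    conv_lhs => rw [← hA]
    simp
  refine Finset.card_bij (fun B _ => ({x : Fin n | CFK.mk σ x ∈ B} : Finset (Fin n))) ?_ ?_ ?_
  · intro B hB
    simp only [mem_filter, mem_univ, true_and] at hB ⊢
    constructor
    · rw [← hB, Finset.card_eq_sum_card_fiberwise (f := CFK.mk σ) (t := B)]
      · refine Finset.sum_congr rfl fun q hq => ?_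
        unfold CFK.wt
        congr 1
        ext x
        simp only [mem_filter, mem_univ, true_and]
        constructor
        · exact fun h => h.2
        · rintro rfl
          exact ⟨hq, rfl⟩
      · intro x hx
        simpa using hx
    · refine Finset.eq_of_subset_of_card_le ?_ ?_
      · intro y hy
        obtain ⟨x, hx, rfl⟩ := Finset.mem_image.1 hy
        simpa [CFK.mk_apply] using hx
      · rw [Finset.card_image_of_injective _ σ.injective]
  · intro B _ B' _ h
    ext q
    obtain ⟨x, rfl⟩ := CFK.mk_surj σ q
    simpa using Finset.ext_iff.1 h x
  · intro A hA
    simp only [mem_filter, mem_univ, true_and] at hA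
    have hinv := inv A hA.2
    have hsame : ∀ x y, σ.SameCycle x y → x ∈ A → y ∈ A := by
      intro x y hxy hx
      obtain ⟨i, -, -, rfl⟩ := hxy.exists_pow_eq'
      clear hxy
      induction i with
      | zero => simpa using hx
      | succ i ih => rw [pow_succ', Perm.mul_apply, hinv]; exact ih
    have hA' : ({x : Fin n | CFK.mk σ x ∈ A.image (CFK.mk σ)} : Finset (Fin n)) = A := by
      ext x
      simp only [mem_filter, mem_univ, true_and, mem_image, CFK.mk_eq]
      constructor
      · rintro ⟨y, hy, h⟩
        exact hsame _ _ h hy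
      · intro hx
        exact ⟨x, hx, Perm.SameCycle.refl _ _⟩
    refine ⟨A.image (CFK.mk σ), ?_, hA'⟩
    simp only [mem_filter, mem_univ, true_and]
    rw [← hA.1]
    conv_rhs => rw [← hA']
    rw [Finset.card_eq_sum_card_fiberwise (f := CFK.mk σ) (t := A.image (CFK.mk σ))]
    · refine Finset.sum_congr rfl fun q hq => ?_
      unfold CFK.wt
      congr 1
      ext x
      simp only [mem_filter, mem_univ, true_and]
      constructor
      · rintro rfl
        exact ⟨hq, rfl⟩
      · exact fun h => h.2
    · intro x hx
      simpa using hx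
end
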